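/- arXiv:2106.08674 — 2 statements merged into one kernel-verified Lean document; each statement's English description precedes it below -/
import Mathlib

section
/- Let G be the complete tripartite graph with parts of sizes a ≥ b ≥ c where a + b + c = 2n and a ≤ n. Then the number of perfect matchings of G equals a!·b!·c! / ((n-a)!·(n-b)!·(n-c)!). -/
open Classical in
/-- Involutions supported on `S` and matching vertices of different colours. -/
noncomputable def PMs {V : Type*} [Fintype V] (f : V → Fin 3) (S : Finset V) :
    Finset (Equiv.Perm V) :=
  Finset.univ.filter fun σ => (∀ x, σ (σ x) = x) ∧ (∀ x, x ∉ S → σ x = x) ∧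
    ∀ x ∈ S, f (σ x) ≠ f x

theorem mem_PMs {V : Type*} [Fintype V] (f : V → Fin 3) (S : Finset V) (σ : Equiv.Perm V) :
    σ ∈ PMs f S ↔ (∀ x, σ (σ x) = x) ∧ (∀ x, x ∉ S → σ x = x) ∧
    ∀ x ∈ S, f (σ x) ≠ f x := by
  simp [PMs]

theorem PMs_maps {V : Type*} [Fintype V] {f : V → Fin 3} {S : Finset V} {σ : Equiv.Perm V}
    (h : σ ∈ PMs f S) {x : V} (hx : x ∈ S) : σ x ∈ S := by
  rw [mem_PMs] at h
  obtain ⟨h1, h2, h3⟩ := h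
  by_contra hc
  have := h2 _ hc
  rw [h1] at this
  exact h3 x hx (by rw [← this])

open Classical in
theorem PMs_fiber {V : Type*} [Fintype V] (f : V → Fin 3) (S : Finset V) (v w : V)
    (hv : v ∈ S) (hw : w ∈ S) (hvw : f v ≠ f w) :
    ((PMs f S).filter fun σ => σ v = w).card = (PMs f ((S.erase v).erase w)).card := by
  have hne : v ≠ w := fun h => hvw (by rw [h])
  refine Finset.card_bij' (fun σ _ => Equiv.swap v w * σ) (fun σ _ => Equiv.swap v w * σ)
    ?_ ?_ ?_ ?_
  · intro σ hσ
    rw [Finset.mem_filter, mem_PMs] at hσ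
    obtain ⟨⟨h1, h2, h3⟩, h4⟩ := hσ
    have h5 : σ w = v := by rw [← h4, h1]
    have key : ∀ x, x ≠ v → x ≠ w → Equiv.swap v w (σ x) = σ x := by
      intro x hxv hxw
      apply Equiv.swap_apply_of_ne_of_ne
      · intro h; exact hxw (σ.injective (h.trans h5.symm))
      · intro h; exact hxv (σ.injective (h.trans h4.symm))
    have key2 : ∀ x, x ≠ v → x ≠ w → σ x ≠ v ∧ σ x ≠ w := by
      intro x hxv hxw
      exact ⟨fun h => hxw (σ.injective (h.trans h5.symm)),
        fun h => hxv (σ.injective (h.trans h4.symm))⟩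
    have kv : Equiv.swap v w (σ v) = v := by rw [h4, Equiv.swap_apply_right]
    have kw : Equiv.swap v w (σ w) = w := by rw [h5, Equiv.swap_apply_left]
    rw [mem_PMs]
    simp only [Equiv.Perm.mul_apply]
    refine ⟨fun x => ?_, fun x hx => ?_, fun x hx => ?_⟩
    · by_cases hxv : x = v
      · subst hxv; rw [kv, kv]
      by_cases hxw : x = w
      · subst hxw; rw [kw, kw]
      rw [key x hxv hxw, key _ (key2 x hxv hxw).1 (key2 x hxv hxw).2, h1]
    · by_cases hxv : x = v
      · subst hxv; rw [kv]
      by_cases hxw : x = w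
      · subst hxw; rw [kw]
      rw [key x hxv hxw]
      exact h2 x (fun h => hx (by simp [hxv, hxw, h]))
    · simp only [Finset.mem_erase] at hx
      rw [key x hx.2.1 hx.1]
      exact h3 x hx.2.2
  · intro σ hσ
    rw [mem_PMs] at hσ
    obtain ⟨h1, h2, h3⟩ := hσ
    have hv' : σ v = v := h2 v (by simp)
    have hw' : σ w = w := h2 w (by simp)
    have key2 : ∀ x, x ≠ v → x ≠ w → σ x ≠ v ∧ σ x ≠ w := by
      intro x hxv hxw
      exact ⟨fun h => hxv (σ.injective (h.trans hv'.symm)),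
        fun h => hxw (σ.injective (h.trans hw'.symm))⟩
    have key : ∀ x, x ≠ v → x ≠ w → Equiv.swap v w (σ x) = σ x := by
      intro x hxv hxw
      exact Equiv.swap_apply_of_ne_of_ne (key2 x hxv hxw).1 (key2 x hxv hxw).2
    have kv : Equiv.swap v w (σ v) = w := by rw [hv', Equiv.swap_apply_left]
    have kw : Equiv.swap v w (σ w) = v := by rw [hw', Equiv.swap_apply_right]
    rw [Finset.mem_filter, mem_PMs]
    simp only [Equiv.Perm.mul_apply]
    refine ⟨⟨fun x => ?_, fun x hx => ?_, fun x hx => ?_⟩, kv⟩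
    · by_cases hxv : x = v
      · subst hxv; rw [kv, kw]
      by_cases hxw : x = w
      · subst hxw; rw [kw, kv]
      rw [key x hxv hxw, key _ (key2 x hxv hxw).1 (key2 x hxv hxw).2, h1]
    · have hxv : x ≠ v := fun h => hx (h ▸ hv)
      have hxw : x ≠ w := fun h => hx (h ▸ hw)
      rw [key x hxv hxw]
      exact h2 x (fun h => hx (by simp only [Finset.mem_erase] at h; exact h.2.2))
    · by_cases hxv : x = v
      · subst hxv; rw [kv]; exact hvw.symm
      by_cases hxw : x = w
      · subst hxw; rw [kw]; exact hvw
      rw [key x hxv hxw]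
      exact h3 x (by simp [hxv, hxw, hx])
  · intro σ _; simp
  · intro σ _; simp

open Classical in
theorem PMs_rec {V : Type*} [Fintype V] (f : V → Fin 3) (S : Finset V) (v : V) (hv : v ∈ S) :
    (PMs f S).card = ∑ w ∈ S.filter (fun w => f w ≠ f v),
      (PMs f ((S.erase v).erase w)).card := by
  rw [Finset.card_eq_sum_card_fiberwise (f := fun σ : Equiv.Perm V => σ v)
    (t := S.filter (fun w => f w ≠ f v))]
  · apply Finset.sum_congr rfl
    intro w hw
    rw [Finset.mem_filter] at hw
    exact PMs_fiber f S v w hv hw.1 hw.2.symm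
  · intro σ hσ
    have hσ' : σ ∈ PMs f S := hσ
    have : σ v ∈ S.filter (fun w => f w ≠ f v) := by
      rw [Finset.mem_filter]
      exact ⟨PMs_maps hσ' hv, ((mem_PMs _ _ _).1 hσ').2.2 v hv⟩
    exact this

theorem PMs_zero {V : Type*} [Fintype V] (f : V → Fin 3) (S : Finset V) (i j l : Fin 3)
    (hij : i ≠ j) (hil : i ≠ l) (hjl : j ≠ l)
    (h : (S.filter fun v => f v = j).card + (S.filter fun v => f v = l).card <
      (S.filter fun v => f v = i).card) : (PMs f S).card = 0 := by
  classical
  by_contra hc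
  obtain ⟨σ, hσ⟩ := Finset.card_pos.1 (Nat.pos_of_ne_zero hc)
  have h1 : (S.filter fun v => f v = i).card ≤
      ((S.filter fun v => f v = j) ∪ (S.filter fun v => f v = l)).card := by
    apply Finset.card_le_card_of_injOn σ
    · intro x hx
      have hx' : x ∈ S ∧ f x = i := by simpa using hx
      have hs := PMs_maps hσ hx'.1
      have hf := ((mem_PMs _ _ _).1 hσ).2.2 x hx'.1
      rw [hx'.2] at hf
      have : f (σ x) = j ∨ f (σ x) = l := by omega
      simpa [hs] using this
    · exact σ.injective.injOn
  have := Finset.card_union_le (S.filter fun v => f v = j) (S.filter fun v => f v = l)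
  omega

open Classical in
theorem card_erase2 {V : Type*} (f : V → Fin 3) (S : Finset V) (v w : V)
    (hv : v ∈ S) (hw : w ∈ S) (hvw : f v ≠ f w) (k : Fin 3) :
    (((S.erase v).erase w).filter fun x => f x = k).card =
      (S.filter fun x => f x = k).card - (if f v = k ∨ f w = k then 1 else 0) := by
  have e : (((S.erase v).erase w).filter fun x => f x = k) =
      ((S.filter fun x => f x = k).erase v).erase w := by
    ext x; simp; tauto
  rw [e, Finset.card_erase_eq_ite, Finset.card_erase_eq_ite]
  have hne : w ≠ v := fun h => hvw (by rw [h])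
  simp only [Finset.mem_erase, Finset.mem_filter, hv, hw]
  by_cases h1 : f v = k <;> by_cases h2 : f w = k <;> simp [h1, h2]
  · exact absurd (h1.trans h2.symm) hvw
  · exact fun h => absurd h hne

theorem PMs_main {V : Type*} [Fintype V] (f : V → Fin 3) (m : ℕ) : ∀ (S : Finset V)
    (_ : S.card = m) (i j l : Fin 3)
    (_ : i ≠ j) (_ : i ≠ l) (_ : j ≠ l) (x y z : ℕ)
    (_ : (S.filter fun v => f v = i).card = y + z)
    (_ : (S.filter fun v => f v = j).card = x + z)
    (_ : (S.filter fun v => f v = l).card = x + y),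
    (PMs f S).card * (x.factorial * y.factorial * z.factorial) =
      (y + z).factorial * (x + z).factorial * (x + y).factorial := by
  classical
  induction m using Nat.strong_induction_on with
  | _ m ih =>
  -- the main step
  have step : ∀ (S : Finset V)
    (_ : S.card = m) (i j l : Fin 3)
    (_ : i ≠ j) (_ : i ≠ l) (_ : j ≠ l) (x y z : ℕ)
    (_ : (S.filter fun v => f v = i).card = y + z)
    (_ : (S.filter fun v => f v = j).card = x + z)
    (_ : (S.filter fun v => f v = l).card = x + y) (_ : 0 < y + z),
    (PMs f S).card * (x.factorial * y.factorial * z.factorial) =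
      (y + z).factorial * (x + z).factorial * (x + y).factorial := by
    intro S hS i j l hij hil hjl x y z hi hj hl hpos
    obtain ⟨v, hv⟩ := Finset.card_pos.1 (by rw [hi]; exact hpos)
    rw [Finset.mem_filter] at hv
    obtain ⟨hvS, hvi⟩ := hv
    rw [PMs_rec f S v hvS]
    have hcard : ∀ w ∈ S, f w ≠ f v → ((S.erase v).erase w).card < m := by
      intro w hw hwv
      rw [← hS]
      exact lt_of_le_of_lt (Finset.card_le_card (Finset.erase_subset _ _))
        (Finset.card_erase_lt_of_mem hvS)
    have hsplit : S.filter (fun w => f w ≠ f v) =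
        S.filter (fun w => f w = j) ∪ S.filter (fun w => f w = l) := by
      ext w
      simp only [Finset.mem_filter, Finset.mem_union, ← and_or_left, hvi]
      have : f w ≠ i ↔ f w = j ∨ f w = l := by omega
      rw [this]
    have hdisj : Disjoint (S.filter (fun w => f w = j)) (S.filter (fun w => f w = l)) := by
      rw [Finset.disjoint_filter]
      intro w _ h1 h2
      exact hjl (h1.symm.trans h2)
    rw [hsplit, Finset.sum_union hdisj, add_mul, Finset.sum_mul, Finset.sum_mul]
    have A : ∀ w ∈ S.filter (fun w => f w = j),
        (PMs f ((S.erase v).erase w)).card * (x.factorial * y.factorial * z.factorial) =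
        z * ((y + z - 1).factorial * (x + z - 1).factorial * (x + y).factorial) := by
      intro w hw
      rw [Finset.mem_filter] at hw
      have hne : f v ≠ f w := by rw [hvi, hw.2]; exact hij
      have ci := card_erase2 f S v w hvS hw.1 hne i
      have cj := card_erase2 f S v w hvS hw.1 hne j
      have cl := card_erase2 f S v w hvS hw.1 hne l
      rw [hvi, hw.2] at ci cj cl
      simp only [true_or, or_true, if_true, hil, hjl, or_self, if_false] at ci cj cl
      rw [hi] at ci
      rw [hj] at cj
      rw [hl] at cl
      rcases z with _ | z
      · rw [PMs_zero f _ l i j hil.symm hjl.symm hij (by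
          have : 0 < x + 0 := by rw [← hj]; exact Finset.card_pos.2 ⟨w, by simp [hw]⟩
          omega)]
        simp
      · have := ih _ (hcard w hw.1 hne.symm) _ rfl i j l hij hil hjl x y z
          (by omega) (by omega) (by omega)
        rw [Nat.factorial_succ z]
        simp only [← Nat.add_assoc, Nat.add_sub_cancel]
        rw [← this]; ring
    have B : ∀ w ∈ S.filter (fun w => f w = l),
        (PMs f ((S.erase v).erase w)).card * (x.factorial * y.factorial * z.factorial) =
        y * ((y + z - 1).factorial * (x + z).factorial * (x + y - 1).factorial) := by
      intro w hw
      rw [Finset.mem_filter] at hw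
      have hne : f v ≠ f w := by rw [hvi, hw.2]; exact hil
      have ci := card_erase2 f S v w hvS hw.1 hne i
      have cj := card_erase2 f S v w hvS hw.1 hne j
      have cl := card_erase2 f S v w hvS hw.1 hne l
      rw [hvi, hw.2] at ci cj cl
      simp only [true_or, or_true, if_true, hij, hjl.symm, or_self, if_false] at ci cj cl
      rw [hi] at ci
      rw [hj] at cj
      rw [hl] at cl
      rcases y with _ | y
      · rw [PMs_zero f _ j i l hij.symm hjl hil (by
          have : 0 < x + 0 := by rw [← hl]; exact Finset.card_pos.2 ⟨w, by simp [hw]⟩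
          omega)]
        simp
      · have := ih _ (hcard w hw.1 hne.symm) _ rfl i j l hij hil hjl x y z
          (by omega) (by omega) (by omega)
        rw [Nat.factorial_succ y]
        have e1 : y + 1 + z - 1 = y + z := by omega
        have e2 : x + (y + 1) - 1 = x + y := by omega
        rw [e1, e2, ← this]; ring
    rw [Finset.sum_congr rfl A, Finset.sum_congr rfl B, Finset.sum_const, Finset.sum_const,
      hj, hl, smul_eq_mul, smul_eq_mul]
    have e1 : (x + z) * (z * ((y + z - 1).factorial * (x + z - 1).factorial * (x + y).factorial))
        = z * ((y + z - 1).factorial * (x + z).factorial * (x + y).factorial) := by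
      rcases Nat.eq_zero_or_pos (x + z) with h | h
      · have : z = 0 := by omega
        simp [this]
      · rw [← Nat.mul_factorial_pred h.ne']; ring
    have e2 : (x + y) * (y * ((y + z - 1).factorial * (x + z).factorial * (x + y - 1).factorial))
        = y * ((y + z - 1).factorial * (x + z).factorial * (x + y).factorial) := by
      rcases Nat.eq_zero_or_pos (x + y) with h | h
      · have : y = 0 := by omega
        simp [this]
      · rw [← Nat.mul_factorial_pred h.ne']; ring
    rw [e1, e2, ← Nat.mul_factorial_pred hpos.ne']
    ring
  intro S hS i j l hij hil hjl x y z hi hj hl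
  by_cases h1 : 0 < y + z
  · exact step S hS i j l hij hil hjl x y z hi hj hl h1
  by_cases h2 : 0 < x + z
  · have := step S hS j i l hij.symm hjl hil y x z hj hi (by omega) h2
    rw [Nat.add_comm y x] at this
    linarith
  have hx : x = 0 := by omega
  have hy : y = 0 := by omega
  have hz : z = 0 := by omega
  subst hx hy hz
  have hSe : S = ∅ := by
    rw [Finset.eq_empty_iff_forall_notMem]
    intro v hv
    simp only [Nat.add_zero, Finset.card_eq_zero, Finset.filter_eq_empty_iff] at hi hj hl
    have a1 := hi hv
    have a2 := hj hv
    have a3 := hl hv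
    omega
  have : PMs f S = {1} := by
    ext σ
    rw [mem_PMs, Finset.mem_singleton, hSe]
    constructor
    · rintro ⟨_, h, _⟩
      ext x; simpa using h x (by simp)
    · rintro rfl; simp
  simp [this]

theorem PMs_ncard {V : Type*} [Fintype V] (f : V → Fin 3)
    (G : SimpleGraph V) (hG : ∀ u v : V, G.Adj u v ↔ f u ≠ f v) :
    {M : G.Subgraph | M.IsPerfectMatching}.ncard = (PMs f Finset.univ).card := by
  rw [← Set.ncard_coe_finset]
  symm
  have hmem : ∀ σ ∈ (↑(PMs f Finset.univ) : Set (Equiv.Perm V)),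
      (∀ x, σ (σ x) = x) ∧ ∀ x, f (σ x) ≠ f x := by
    intro σ hσ
    have := (mem_PMs _ _ _).1 (Finset.mem_coe.1 hσ)
    exact ⟨this.1, fun x => this.2.2 x (Finset.mem_univ _)⟩
  refine Set.ncard_congr (fun σ hσ =>
    { verts := Set.univ
      Adj := fun u v => σ u = v
      adj_sub := ?_
      edge_vert := fun _ => Set.mem_univ _
      symm := ?_ }) ?_ ?_ ?_
  · rintro u v rfl
    rw [hG]; exact ((hmem σ hσ).2 u).symm
  · first
    | (rintro u v rfl; exact (hmem σ hσ).1 u)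
    | (constructor; rintro u v rfl; exact (hmem σ hσ).1 u)
  · intro σ hσ
    simp only [Set.mem_ofPred_eq]
    rw [SimpleGraph.Subgraph.isPerfectMatching_iff]
    intro v
    exact ⟨σ v, rfl, fun y hy => Eq.symm (show σ v = y from hy)⟩
  · intro σ τ hσ hτ h
    have h' := congrArg SimpleGraph.Subgraph.Adj h
    ext x
    have := congrFun (congrFun h' x) (τ x)
    simpa using this
  · intro M hM
    have hM' : M.IsPerfectMatching := hM
    have hM2 := SimpleGraph.Subgraph.isPerfectMatching_iff.1 hM'
    choose g hg hu using hM2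
    have hinv : Function.Involutive g := fun x => (hu (g x) x (hg x).symm).symm
    refine ⟨hinv.toPerm g, ?_, ?_⟩
    · rw [Finset.mem_coe, mem_PMs]
      refine ⟨fun x => hinv x, fun x hx => absurd (Finset.mem_univ x) hx, fun x _ => ?_⟩
      exact ((hG _ _).1 (hg x).adj_sub).symm
    · ext u v
      · simp [hM'.2 u]
      · change g u = v ↔ M.Adj u v
        exact ⟨fun h => h ▸ hg u, fun h => (hu u v h).symm⟩

/-- The number of perfect matchings of the complete tripartite graph with parts of
sizes `a ≥ b ≥ c`, `a + b + c = 2n`, `a ≤ n`, equals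
`a! b! c! / ((n-a)! (n-b)! (n-c)!)` (stated in multiplied-out form). -/
theorem stmt_11 (n a b c : ℕ) (hab : b ≤ a) (hbc : c ≤ b)
    (hsum : a + b + c = 2 * n) (han : a ≤ n)
    (V : Type*) [Fintype V] (f : V → Fin 3)
    (ha : (Finset.univ.filter fun v => f v = 0).card = a)
    (hb : (Finset.univ.filter fun v => f v = 1).card = b)
    (hc : (Finset.univ.filter fun v => f v = 2).card = c)
    (G : SimpleGraph V) (hG : ∀ u v : V, G.Adj u v ↔ f u ≠ f v) :
    {M : G.Subgraph | M.IsPerfectMatching}.ncard *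
      (Nat.factorial (n - a) * Nat.factorial (n - b) * Nat.factorial (n - c)) =
    Nat.factorial a * Nat.factorial b * Nat.factorial c := by
  rw [PMs_ncard f G hG]
  have ea : n - b + (n - c) = a := by omega
  have eb : n - a + (n - c) = b := by omega
  have ec : n - a + (n - b) = c := by omega
  have := PMs_main f _ Finset.univ rfl 0 1 2 (by decide) (by decide) (by decide)
    (n - a) (n - b) (n - c) (by rw [ha, ea]) (by rw [hb, eb]) (by rw [hc, ec])
  rw [ea, eb, ec] at this
  exact this
end

section
/- Every n-vertex graph G admits a family P of at most 2n/3 edge-disjoint paths whose edge sets cover E(G). Consequently (corollary): for any ε > 0, if e(G) ≥ 2n/ε then there is a family M of edge-disjoint matchings in G with |M| ≤ 2n, with every matching in M of size at least ε·e(G)/(2n), and with the edges not covered by M numbering at most 2ε·e(G). -/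
section DK


open Finset

/-- multiset of consecutive pairs -/
def ed {V : Type*} : List V → Multiset (Sym2 V)
  | [] => 0
  | [_] => 0
  | a :: b :: l => s(a, b) ::ₘ ed (b :: l)

section lists
variable {V : Type*}

@[simp] lemma ed_nil : ed ([] : List V) = 0 := rfl
@[simp] lemma ed_single (a : V) : ed [a] = 0 := rfl
@[simp] lemma ed_cons_cons (a b : V) (l : List V) : ed (a :: b :: l) = {s(a, b)} + ed (b :: l) := rfl

lemma ed_append (l r : List V) (a : V) : ed (l ++ a :: r) = ed (l ++ [a]) + ed (a :: r) := by
  induction l with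
  | nil => simp
  | cons x l ih =>
    cases l with
    | nil => simp
    | cons y l =>
      simp only [List.cons_append, ed_cons_cons] at ih ⊢
      rw [ih, add_assoc]

lemma ed_reverse (l : List V) : ed l.reverse = ed l := by
  induction l with
  | nil => simp
  | cons x l ih =>
    cases l with
    | nil => simp
    | cons y l =>
      simp only [List.reverse_cons, List.append_assoc, List.cons_append, List.nil_append, ed_cons_cons] at ih ⊢
      rw [ed_append, ih]
      simp only [ed_cons_cons, ed_single, add_zero, Sym2.eq_swap (a := y)]
      rw [add_comm]

variable [Inhabited V]

/-- last element -/
def lst (l : List V) : V := l.reverse.headI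

@[simp] lemma lst_append_single (l : List V) (a : V) : lst (l ++ [a]) = a := by simp [lst]
@[simp] lemma lst_append_cons (l r : List V) (a : V) : lst (l ++ a :: r) = lst (a :: r) := by
  unfold lst
  rcases List.eq_nil_or_concat r with h | ⟨s, t, h⟩ <;> subst h <;> simp
@[simp] lemma lst_cons_cons (l : List V) (a b : V) : lst (a :: b :: l) = lst (b :: l) := 
  lst_append_cons [a] l b
@[simp] lemma lst_single (a : V) : lst [a] = a := rfl
@[simp] lemma lst_reverse (l : List V) : lst l.reverse = l.headI := by simp [lst]
lemma headI_reverse (l : List V) : l.reverse.headI = lst l := rfl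
lemma lst_mem {l : List V} (h : l ≠ []) : lst l ∈ l := by
  rcases List.eq_nil_or_concat l with h | ⟨s, t, h⟩ <;> subst h <;> simp_all
lemma headI_mem {l : List V} (h : l ≠ []) : l.headI ∈ l := by
  cases l <;> simp_all
lemma headI_append {l : List V} (h : l ≠ []) (r : List V) : (l ++ r).headI = l.headI := by
  cases l <;> simp_all

lemma ed_cons {l : List V} (h : l ≠ []) (a : V) : ed (a :: l) = {s(a, l.headI)} + ed l := by
  cases l <;> simp_all
lemma ed_concat {l : List V} (h : l ≠ []) (a : V) : ed (l ++ [a]) = {s(a, lst l)} + ed l := by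
  rw [← ed_reverse, List.reverse_append, List.reverse_singleton, List.singleton_append,
    ed_cons (by simpa), ed_reverse]; rfl
lemma lst_append {r : List V} (h : r ≠ []) (l : List V) : lst (l ++ r) = lst r := by
  cases r <;> simp_all

/-- number of ends at `v` -/
def en [DecidableEq V] (l : List V) (v : V) : ℕ :=
  (if l.headI = v then 1 else 0) + (if lst l = v then 1 else 0)

lemma ed_parity [DecidableEq V] (l : List V) (h : l.Nodup) (hn : l ≠ []) (v : V) :
    (ed l).countP (fun e => v ∈ e) + en l v = 2 * (if v ∈ l then 1 else 0) := by
  induction l with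
  | nil => simp at hn
  | cons x l ih =>
    cases l with
    | nil => simp [en, eq_comm]; split_ifs <;> rfl
    | cons y l =>
      have ih := ih h.of_cons (by simp)
      simp only [ed_cons_cons, Multiset.singleton_add, Multiset.countP_cons, en, lst_cons_cons, List.headI_cons] at ih ⊢
      simp only [List.nodup_cons, List.mem_cons, Sym2.mem_iff] at *
      grind

end lists


open Finset
set_option linter.unusedSectionVars false

section pp
variable {V : Type*} [Inhabited V] [DecidableEq V]

/-- neighbour of `a` in `P` on the left side (default `a`) -/
def nxL (a : V) (P : List V) : V :=
  if a ∈ P then lst (a :: P.takeWhile (fun x => decide (x ≠ a))) else a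

/-- the end vertex of `P` -/
def vt (P : List V) : Bool → V
  | false => P.headI
  | true => lst P

/-- neighbour of `a` on the side of the given end -/
def nx (a : V) (P : List V) : Bool → V
  | false => nxL a P
  | true => nxL a P.reverse

lemma nxL_split (a : V) (l r : List V) (h : a ∉ l) : nxL a (l ++ a :: r) = lst (a :: l) := by
  unfold nxL
  rw [if_pos (by simp), List.takeWhile_append_of_pos]
  · simp
  · intro x hx
    simp only [decide_eq_true_eq]
    rintro rfl; exact h hx

lemma nxL_split' (a : V) (l r : List V) (h : (l ++ a :: r).Nodup) :
    nxL a (l ++ a :: r).reverse = (r ++ [a]).headI := by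
  have : (l ++ a :: r).reverse = r.reverse ++ a :: l.reverse := by simp
  rw [this, nxL_split]
  · rw [← headI_reverse]; simp
  · have := (List.nodup_append.1 h).2.1
    simp at this
    simpa using this.1

lemma nx_notMem (a : V) (P : List V) (h : a ∉ P) (s : Bool) : nx a P s = a := by
  cases s <;> simp [nx, nxL, h]

lemma en_eq (P : List V) (v : V) : en P v = (if vt P false = v then 1 else 0) + (if vt P true = v then 1 else 0) := rfl

lemma lst_mem_edge (a : V) (l r : List V) (h : l ≠ []) : s(a, lst l) ∈ ed (l ++ a :: r) := by
  rw [ed_append, ed_concat h]; simp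

lemma head_mem_edge (a : V) (l r : List V) (h : r ≠ []) : s(a, r.headI) ∈ ed (l ++ a :: r) := by
  rw [ed_append, ed_cons h]; simp

lemma lst_cons' (a : V) (l : List V) (h : l ≠ []) : lst (a :: l) = lst l := by
  cases l <;> simp_all

lemma nx_edge (a : V) (P : List V) (hP : P.Nodup) (s : Bool) (h : nx a P s ≠ a) : s(a, nx a P s) ∈ ed P := by
  by_cases ha : a ∈ P
  · obtain ⟨l, r, rfl⟩ := List.append_of_mem ha
    have hl : a ∉ l := by
      intro h'
      exact (List.nodup_append.1 hP).2.2 a h' a (by simp) rfl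
    cases s
    · simp only [nx] at *
      rw [nxL_split a l r hl] at h ⊢
      by_cases h0 : l = []
      · subst h0; simp at h
      · rw [lst_cons' a l h0]; exact lst_mem_edge a l r h0
    · simp only [nx] at *
      rw [nxL_split' a l r hP] at h ⊢
      by_cases h0 : r = []
      · subst h0; simp at h
      · rw [headI_append h0]; exact head_mem_edge a l r h0
  · exact absurd (nx_notMem a P ha s) h

lemma nx_sides (a : V) (P : List V) (hP : P.Nodup) (h : nx a P false ≠ a) (h' : nx a P false = nx a P true) : False := by
  by_cases ha : a ∈ P
  · obtain ⟨l, r, rfl⟩ := List.append_of_mem ha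
    have hd := (List.nodup_append.1 hP).2.2
    have hl : a ∉ l := fun h' => hd a h' a (by simp) rfl
    simp only [nx] at *
    rw [nxL_split a l r hl] at h h'
    rw [nxL_split' a l r hP] at h'
    by_cases h0 : l = []
    · subst h0; simp at h
    rw [lst_cons' a l h0] at h h'
    by_cases h1 : r = []
    · subst h1; simp at h'; exact h h'
    rw [headI_append h1] at h'
    exact hd _ (lst_mem h0) _ (List.mem_cons_of_mem _ (headI_mem h1)) h'
  · exact absurd (nx_notMem a P ha _) h

lemma headI_reverse_append_cons (a : V) (l r : List V) : (l.reverse ++ a :: r).headI = lst (a :: l) := by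
  rw [← headI_reverse]; simp
  cases h : l.reverse <;> simp

lemma pp (a : V) (P : List V) (hP : P.Nodup) (hn : P ≠ []) (u : Bool → Prop) [DecidablePred u]
    (hu : ∀ s, u s → vt P s ≠ a) (hK : ¬ (u false ∧ u true ∧ a ∉ P)) :
    ∃ P' : List V, P'.Nodup ∧ P' ≠ [] ∧
      ed P' + ∑ s, (if u s ∧ nx a P s ≠ a then {s(a, nx a P s)} else 0) =
        ed P + ∑ s, (if u s then {s(a, vt P s)} else 0) ∧
      ∀ s, vt P' s = if u s then nx a P s else vt P s := by
  by_cases ha : a ∈ P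
  · obtain ⟨l, r, rfl⟩ := List.append_of_mem ha
    have hd := (List.nodup_append.1 hP).2.2
    have hl : a ∉ l := fun h' => hd a h' a (by simp) rfl
    refine ⟨(if u false then l.reverse else l) ++ a :: (if u true then r.reverse else r), ?_, by simp, ?_, ?_⟩
    · have : List.Perm ((if u false then l.reverse else l) ++ a :: (if u true then r.reverse else r)) (l ++ a :: r) := by
        refine List.Perm.append ?_ (List.Perm.cons _ ?_)
        · split_ifs <;> simp
        · split_ifs <;> simp
      exact this.nodup_iff.2 hP
    · have e1 : ed ((if u false then l.reverse else l) ++ [a]) + (if u false ∧ lst (a :: l) ≠ a then {s(a, lst (a :: l))} else 0)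
        = ed (l ++ [a]) + (if u false then {s(a, (l ++ [a]).headI)} else 0) := by
        by_cases h : u false
        · have := hu _ h
          have h0 : l ≠ [] := by rintro rfl; simp [vt] at this
          rw [lst_cons' a l h0, headI_append h0]
          have h2 : lst l ≠ a := by
            intro h2; exact hl (h2 ▸ lst_mem h0)
          simp only [h, h2, if_true, true_and, ne_eq, not_false_eq_true]
          rw [ed_concat (by simpa), ed_concat h0, ed_reverse, lst_reverse]
          abel
        · simp [h]
      have e2 : ed (a :: (if u true then r.reverse else r)) + (if u true ∧ (r ++ [a]).headI ≠ a then {s(a, (r ++ [a]).headI)} else 0)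
        = ed (a :: r) + (if u true then {s(a, lst (a :: r))} else 0) := by
        by_cases h : u true
        · have := hu _ h
          have h0 : r ≠ [] := by rintro rfl; simp [vt] at this
          rw [lst_cons' a r h0, headI_append h0]
          have h2 : r.headI ≠ a := by
            intro h2
            have h3 := (List.nodup_append.1 hP).2.1
            rw [List.nodup_cons] at h3
            exact h3.1 (h2 ▸ headI_mem h0)
          simp only [h, h2, if_true, true_and, ne_eq, not_false_eq_true]
          rw [ed_cons (by simpa), ed_cons h0, ed_reverse, headI_reverse]
          abel
        · simp [h]
      rw [Fintype.sum_bool, Fintype.sum_bool]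
      have h1 : nx a (l ++ a :: r) false = lst (a :: l) := nxL_split a l r hl
      have h2 : nx a (l ++ a :: r) true = (r ++ [a]).headI := nxL_split' a l r hP
      have h3 : vt (l ++ a :: r) false = (l ++ [a]).headI := by cases l <;> simp [vt]
      have h4 : vt (l ++ a :: r) true = lst (a :: r) := lst_append_cons _ _ _
      simp only [h1, h2, h3, h4]
      rw [ed_append, ed_append l r]
      rw [add_comm (ite _ _ _) (ite _ _ _), add_add_add_comm, e1, e2]
      abel
    · intro s
      cases s
      · simp only [nx, vt]
        rw [nxL_split a l r hl]
        split_ifs <;> first | exact headI_reverse_append_cons _ _ _ | (cases l <;> simp)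
      · simp only [nx, vt]
        rw [nxL_split' a l r hP, lst_append_cons, lst_append_cons]
        split_ifs
        · rw [← headI_reverse]; simp
        · rfl
  · have h1 := nx_notMem a P ha
    rw [Fintype.sum_bool, Fintype.sum_bool]
    simp only [h1, Bool.forall_bool]
    by_cases hf : u false <;> by_cases ht : u true
    · exact absurd ⟨hf, ht, ha⟩ hK
    · refine ⟨a :: P, by simp [ha, hP], by simp, ?_, ?_⟩
      · simp [hf, ht, ed_cons hn, vt, add_comm]
      · simp [hf, ht, vt, lst_cons' a P hn]
    · refine ⟨P ++ [a], ?_, by simp, ?_, ?_⟩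
      · simp only [List.nodup_append, hP, true_and, List.nodup_singleton, List.mem_singleton]
        rintro x hx y rfl rfl; exact ha hx
      · simp [hf, ht, ed_concat hn, vt, add_comm]
      · simp [hf, ht, vt, headI_append hn]
    · exact ⟨P, hP, hn, by simp [hf, ht], by simp [hf, ht]⟩
end pp


open Finset
set_option linter.unusedSectionVars false

section core
variable {V : Type*} [Inhabited V] [DecidableEq V] {ι : Type} [Fintype ι] [DecidableEq ι]

/-- total number of path ends at `v` -/
def D (P : ι → List V) (v : V) : ℕ := ∑ i, en (P i) v

lemma sum_pairs {M : Type*} [AddCommMonoid M] (f : ι → Bool → M) :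
    ∑ i, ∑ s, f i s = ∑ e : ι × Bool, f e.1 e.2 := by
  rw [Fintype.sum_prod_type]

lemma D_eq (P : ι → List V) (v : V) : D P v = #(univ.filter (fun e : ι × Bool => vt (P e.1) e.2 = v)) := by
  rw [Finset.card_filter, ← sum_pairs (fun i s => if vt (P i) s = v then 1 else 0)]
  unfold D
  refine Finset.sum_congr rfl fun i _ => ?_
  rw [Fintype.sum_bool, en_eq, add_comm]

lemma core (a : V) (P : ι → List V) (hP : ∀ i, (P i).Nodup) (hn : ∀ i, P i ≠ [])
    (U : Finset (ι × Bool)) (X : Multiset V) (hU : ∀ e ∈ U, vt (P e.1) e.2 ≠ a)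
    (hb : U.val.map (fun e => vt (P e.1) e.2) =
      X + (U.filter (fun e => nx a (P e.1) e.2 ≠ a)).val.map (fun e => nx a (P e.1) e.2)) :
    ∃ (K : Finset ι) (P' : ι → List V), (∀ i ∈ K, a ∉ P i) ∧ 2 * #K ≤ X.card ∧
      (∀ i, (P' i).Nodup) ∧ (∀ i, P' i ≠ []) ∧
      (∑ i ∈ Kᶜ, ed (P' i) + ∑ i ∈ K, (ed (P i) + {s(a, (P i).headI)} + {s(a, lst (P i))})
        = ∑ i, ed (P i) + X.map (fun x => s(a, x))) ∧
      ∀ v, ∑ i ∈ Kᶜ, en (P' i) v + (if v = a then 2 * #K else 0) + X.count v =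
        D P v + if v = a then X.card else 0 := by
  classical
  set K : Finset ι := univ.filter (fun i => (i, false) ∈ U ∧ (i, true) ∈ U ∧ a ∉ P i) with hKdef
  have hex : ∀ i, ∃ P' : List V, P'.Nodup ∧ P' ≠ [] ∧ (i ∉ K → 
      ed P' + ∑ s, (if (i, s) ∈ U ∧ nx a (P i) s ≠ a then {s(a, nx a (P i) s)} else 0) =
        ed (P i) + ∑ s, (if (i, s) ∈ U then {s(a, vt (P i) s)} else 0) ∧
      ∀ s, vt P' s = if (i, s) ∈ U then nx a (P i) s else vt (P i) s) := by
    intro i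
    by_cases hi : i ∈ K
    · exact ⟨P i, hP i, hn i, fun h => absurd hi h⟩
    · have := pp a (P i) (hP i) (hn i) (fun s => (i, s) ∈ U) (fun s hs => hU _ hs) (by
        simpa [hKdef] using hi)
      obtain ⟨P', h1, h2, h3, h4⟩ := this
      exact ⟨P', h1, h2, fun _ => ⟨h3, h4⟩⟩
  choose P' h1 h2 h3 using hex
  have hKa : ∀ i ∈ K, a ∉ P i := fun i hi => by simp [hKdef] at hi; exact hi.2.2
  have hK0 : ∀ i ∈ K, ∀ s, (i, s) ∈ U := fun i hi s => by
    simp [hKdef] at hi; cases s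
    exacts [hi.1, hi.2.1]
  -- count identities
  have hcnt : ∀ v, #(U.filter (fun e => vt (P e.1) e.2 = v)) =
      X.count v + #((U.filter (fun e => nx a (P e.1) e.2 ≠ a)).filter (fun e => nx a (P e.1) e.2 = v)) := by
    intro v
    have := congrArg (Multiset.count v) hb
    rw [Multiset.count_add, Multiset.count_map, Multiset.count_map] at this
    simp only [eq_comm (a := v)] at this
    exact this
  have hcard : #U = X.card + #(U.filter (fun e => nx a (P e.1) e.2 ≠ a)) := by
    have := congrArg Multiset.card hb
    rw [Multiset.card_add, Multiset.card_map, Multiset.card_map] at this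
    exact this
  have hcard2 : #(U.filter (fun e => nx a (P e.1) e.2 = a)) = X.card := by
    have := Finset.card_filter_add_card_filter_not (s := U) (fun e => nx a (P e.1) e.2 = a)
    simp only [ne_eq] at hcard
    omega
  have h2K : 2 * #K ≤ #(U.filter (fun e => nx a (P e.1) e.2 = a)) := by
    have : #(K ×ˢ (univ : Finset Bool)) ≤ #(U.filter (fun e => nx a (P e.1) e.2 = a)) := by
      apply Finset.card_le_card
      rintro ⟨i, s⟩ h
      simp only [Finset.mem_product, Finset.mem_univ, and_true] at h
      exact Finset.mem_filter.2 ⟨hK0 i h s, nx_notMem _ _ (hKa i h) _⟩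
    rw [Finset.card_product] at this
    simpa [mul_comm] using this
  refine ⟨K, P', hKa, by omega, h1, h2, ?_, ?_⟩
  · -- edges
    have hT : ∀ i, (if i ∈ K then (ed (P i) + {s(a, (P i).headI)} + {s(a, lst (P i))}) else ed (P' i)) +
        ∑ s, (if (i, s) ∈ U ∧ nx a (P i) s ≠ a then {s(a, nx a (P i) s)} else 0) =
        ed (P i) + ∑ s, (if (i, s) ∈ U then {s(a, vt (P i) s)} else 0) := by
      intro i
      by_cases hi : i ∈ K
      · simp [hi, hK0 i hi, nx_notMem _ _ (hKa i hi), vt]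
        rw [← Multiset.singleton_add]
        abel
      · rw [if_neg hi]; exact (h3 i hi).1
    have hS := Finset.sum_congr (rfl : (univ : Finset ι) = univ) (fun i _ => hT i)
    rw [Finset.sum_add_distrib, Finset.sum_add_distrib,
      sum_pairs (fun i s => if (i, s) ∈ U ∧ nx a (P i) s ≠ a then ({s(a, nx a (P i) s)} : Multiset (Sym2 V)) else 0),
      sum_pairs (fun i s => if (i, s) ∈ U then ({s(a, vt (P i) s)} : Multiset (Sym2 V)) else 0)] at hS
    simp only [Prod.mk.eta] at hS
    rw [← Finset.sum_filter, ← Finset.sum_filter] at hS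
    have f1 : (univ.filter (fun e : ι × Bool => e ∈ U)) = U := by ext; simp
    have f2 : (univ.filter (fun e : ι × Bool => e ∈ U ∧ nx a (P e.1) e.2 ≠ a)) =
      U.filter (fun e => nx a (P e.1) e.2 ≠ a) := by ext; simp
    rw [f1, f2] at hS
    have g : ∀ (W : Finset (ι × Bool)) (f : ι × Bool → V), ∑ e ∈ W, ({s(a, f e)} : Multiset (Sym2 V)) =
        (W.val.map f).map (fun x => s(a, x)) := by
      intro W f
      rw [Multiset.map_map, ← Multiset.sum_map_singleton (W.val.map _), Multiset.map_map]
      rfl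
    rw [g, g, hb, Multiset.map_add, ← add_assoc, add_left_inj] at hS
    rw [← hS, Finset.sum_ite]
    rw [add_comm]
    congr 1
    · congr 1; ext; simp
    · congr 1; ext; simp
  · intro v
    have hT : ∀ i, (if i ∈ K then (if v = a then 2 else 0) else en (P' i) v) + 
        ∑ s, (if (i, s) ∈ U ∧ vt (P i) s = v then 1 else 0) =
        en (P i) v + ∑ s, (if (i, s) ∈ U ∧ nx a (P i) s = v then 1 else 0) := by
      intro i
      by_cases hi : i ∈ K
      · simp only [hi, hK0 i hi, nx_notMem _ _ (hKa i hi), Fintype.sum_bool, en_eq, if_true, true_and, eq_comm (a := a)]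
        split_ifs <;> omega
      · rw [if_neg hi, en_eq, en_eq, (h3 i hi).2, (h3 i hi).2, Fintype.sum_bool, Fintype.sum_bool]
        by_cases i1 : (i, false) ∈ U <;> by_cases i2 : (i, true) ∈ U <;> simp [i1, i2] <;> omega
    have hS := Finset.sum_congr (rfl : (univ : Finset ι) = univ) (fun i _ => hT i)
    rw [Finset.sum_add_distrib, Finset.sum_add_distrib,
      sum_pairs (fun i s => if (i, s) ∈ U ∧ vt (P i) s = v then 1 else 0),
      sum_pairs (fun i s => if (i, s) ∈ U ∧ nx a (P i) s = v then 1 else 0)] at hS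
    simp only [Prod.mk.eta] at hS
    rw [← Finset.card_filter, ← Finset.card_filter] at hS
    have f1 : (univ.filter (fun e : ι × Bool => e ∈ U ∧ vt (P e.1) e.2 = v)) =
      U.filter (fun e => vt (P e.1) e.2 = v) := by ext; simp
    have f2 : (univ.filter (fun e : ι × Bool => e ∈ U ∧ nx a (P e.1) e.2 = v)) =
      U.filter (fun e => nx a (P e.1) e.2 = v) := by ext; simp
    rw [f1, f2, hcnt v, Finset.sum_ite] at hS
    have f3 : (univ.filter (fun i => i ∉ K)) = Kᶜ := by ext; simp
    have f4 : (univ.filter (fun i => i ∈ K)) = K := by ext; simp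
    rw [f3, f4, Finset.sum_const, smul_eq_mul] at hS
    change _ = D P v + _ at hS
    by_cases hv : v = a
    · subst hv
      rw [hcard2] at hS
      have : #(Finset.filter (fun e => nx v (P e.1) e.2 = v) (Finset.filter (fun e => nx v (P e.1) e.2 ≠ v) U)) = 0 := by
        rw [Finset.card_eq_zero]; ext; simp
      rw [this] at hS
      simp only [if_true] at hS ⊢
      omega
    · have : (Finset.filter (fun e => nx a (P e.1) e.2 = v) (Finset.filter (fun e => nx a (P e.1) e.2 ≠ a) U)) =
        U.filter (fun e => nx a (P e.1) e.2 = v) := by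
        ext e; simp only [Finset.mem_filter]
        constructor
        · rintro ⟨⟨h, _⟩, h'⟩; exact ⟨h, h'⟩
        · rintro ⟨h, h'⟩; exact ⟨⟨h, h' ▸ hv⟩, h'⟩
      rw [this] at hS
      simp only [hv, if_false] at hS ⊢
      omega
end core


open Finset
set_option linter.unusedSectionVars false

section ga
variable {V : Type*} [Inhabited V] [DecidableEq V] {ι : Type} [Fintype ι] [DecidableEq ι]

/-- `P` is a decomposition of the edge set `E` into (possibly trivial) paths -/
structure Dec (E : Finset (Sym2 V)) (P : ι → List V) : Prop where
  nd : ∀ i, (P i).Nodup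
  ne : ∀ i, P i ≠ []
  sum : ∑ i, ed (P i) = E.val

lemma Dec.mem {E : Finset (Sym2 V)} {P : ι → List V} (h : Dec E P) {i : ι} {e : Sym2 V} (he : e ∈ ed (P i)) : e ∈ E := by
  rw [← Finset.mem_val, ← h.sum, Multiset.mem_sum]
  exact ⟨i, by simp, he⟩

lemma Dec.idx {E : Finset (Sym2 V)} {P : ι → List V} (h : Dec E P) {i j : ι} {e : Sym2 V} (he : e ∈ ed (P i))
    (he' : e ∈ ed (P j)) : i = j := by
  by_contra hij
  have h1 : ∑ k ∈ {i, j}, (ed (P k)).count e ≤ ∑ k, (ed (P k)).count e :=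
    Finset.sum_le_sum_of_subset (by simp)
  rw [Finset.sum_pair hij, ← Multiset.count_sum', h.sum] at h1
  have := Multiset.nodup_iff_count_le_one.1 E.nodup e
  have := Multiset.count_pos.2 he
  have := Multiset.count_pos.2 he'
  omega

lemma Dec.nx_mem {E : Finset (Sym2 V)} {P : ι → List V} (h : Dec E P) {a : V} {e : ι × Bool}
    (he : nx a (P e.1) e.2 ≠ a) : s(a, nx a (P e.1) e.2) ∈ E :=
  h.mem (nx_edge a _ (h.nd _) _ he)

lemma Dec.nx_inj {E : Finset (Sym2 V)} {P : ι → List V} (h : Dec E P) {a : V} {e f : ι × Bool}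
    (he : nx a (P e.1) e.2 ≠ a) (hef : nx a (P e.1) e.2 = nx a (P f.1) f.2) : e = f := by
  have h1 := nx_edge a _ (h.nd e.1) _ he
  have h2 := nx_edge a _ (h.nd f.1) f.2 (hef ▸ he)
  rw [← hef] at h2
  obtain ⟨i, s⟩ := e
  obtain ⟨j, t⟩ := f
  obtain rfl := h.idx h1 h2
  congr 1
  cases s <;> cases t <;> try rfl
  · exact (nx_sides a (P i) (h.nd i) he hef).elim
  · exact (nx_sides a (P i) (h.nd i) (hef ▸ he) hef.symm).elim

lemma bal {E : Finset (Sym2 V)} {P : ι → List V} (h : Dec E P) (a : V) (X0 C : Finset (ι × Bool))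
    (hX : ∀ e ∈ X0, vt (P e.1) e.2 ≠ a ∧ s(a, vt (P e.1) e.2) ∉ E)
    (asg : V → ι × Bool) (hXC : X0 ⊆ C)
    (hC : ∀ e ∈ C, nx a (P e.1) e.2 ≠ a → asg (nx a (P e.1) e.2) ∈ C ∧
      vt (P (asg (nx a (P e.1) e.2)).1) (asg (nx a (P e.1) e.2)).2 = nx a (P e.1) e.2) :
    ∃ U : Finset (ι × Bool), (∀ e ∈ U, vt (P e.1) e.2 ≠ a) ∧
      U.val.map (fun e => vt (P e.1) e.2) = X0.val.map (fun e => vt (P e.1) e.2) +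
        (U.filter (fun e => nx a (P e.1) e.2 ≠ a)).val.map (fun e => nx a (P e.1) e.2) := by
  classical
  let Q : Finset (ι × Bool) → Prop := fun C => X0 ⊆ C ∧ ∀ e ∈ C, nx a (P e.1) e.2 ≠ a → asg (nx a (P e.1) e.2) ∈ C
  set U : Finset (ι × Bool) := univ.filter (fun e => ∀ C, Q C → e ∈ C) with hUd
  have hQC : Q C := ⟨hXC, fun e he h' => (hC e he h').1⟩
  have hUC : U ⊆ C := fun e he => (Finset.mem_filter.1 he).2 C hQC
  have hQU : Q U := by
    refine ⟨fun e he => ?_, fun e he h' => ?_⟩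
    · exact Finset.mem_filter.2 ⟨by simp, fun C hC => hC.1 he⟩
    · exact Finset.mem_filter.2 ⟨by simp, fun C hC => hC.2 e ((Finset.mem_filter.1 he).2 C hC) h'⟩
  set T := U.filter (fun e => nx a (P e.1) e.2 ≠ a) with hT
  have hTv : ∀ e ∈ T, vt (P (asg (nx a (P e.1) e.2)).1) (asg (nx a (P e.1) e.2)).2 = nx a (P e.1) e.2 := by
    intro e he
    rw [hT, Finset.mem_filter] at he
    exact (hC e (hUC he.1) he.2).2
  have hinj : Set.InjOn (fun e : ι × Bool => asg (nx a (P e.1) e.2)) T := by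
    intro e he f hf hef
    have h1 := hTv e he
    have h2 := hTv f hf
    simp only at hef
    rw [hef, h2] at h1
    have he' := (Finset.mem_filter.1 he).2
    exact h.nx_inj he' h1.symm
  have hdisj : Disjoint X0 (T.image (fun e : ι × Bool => asg (nx a (P e.1) e.2))) := by
    rw [Finset.disjoint_left]
    intro x hx hx'
    obtain ⟨e, he, rfl⟩ := Finset.mem_image.1 hx'
    have h2 := (hX _ hx).2
    rw [hTv e he] at h2
    exact h2 (h.nx_mem (Finset.mem_filter.1 he).2)
  have hUeq : U = X0.disjUnion _ hdisj := by
    rw [Finset.disjUnion_eq_union]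
    apply Finset.Subset.antisymm
    · intro e he
      refine (Finset.mem_filter.1 he).2 _ ⟨Finset.subset_union_left, fun f hf hf' => ?_⟩
      have hfU : f ∈ U := by
        rcases Finset.mem_union.1 hf with h | h
        · exact hQU.1 h
        · obtain ⟨g, hg, rfl⟩ := Finset.mem_image.1 h
          exact hQU.2 g (Finset.mem_filter.1 hg).1 (Finset.mem_filter.1 hg).2
      exact Finset.mem_union_right _ (Finset.mem_image.2 ⟨f, Finset.mem_filter.2 ⟨hfU, hf'⟩, rfl⟩)
    · apply Finset.union_subset hQU.1
      intro e he
      obtain ⟨g, hg, rfl⟩ := Finset.mem_image.1 he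
      exact hQU.2 g (Finset.mem_filter.1 hg).1 (Finset.mem_filter.1 hg).2
  refine ⟨U, ?_, ?_⟩
  · intro e he
    rw [hUeq, Finset.mem_disjUnion] at he
    rcases he with he | he
    · exact (hX e he).1
    · obtain ⟨g, hg, rfl⟩ := Finset.mem_image.1 he
      rw [hTv g hg]; exact (Finset.mem_filter.1 hg).2
  · conv_lhs => rw [hUeq]
    rw [Finset.disjUnion_val, Multiset.map_add, Finset.image_val_of_injOn hinj, Multiset.map_map]
    congr 1
    apply Multiset.map_congr rfl
    intro e he
    exact hTv e he

lemma D_pos (P : ι → List V) (v : V) (h : D P v ≠ 0) : ∃ e : ι × Bool, vt (P e.1) e.2 = v := by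
  rw [D_eq, Finset.card_ne_zero] at h
  obtain ⟨e, he⟩ := h
  exact ⟨e, (Finset.mem_filter.1 he).2⟩

lemma exists_asg (P : ι → List V) (d : ι × Bool) : ∃ asg : V → ι × Bool, ∀ v, D P v ≠ 0 → vt (P (asg v).1) (asg v).2 = v := by
  classical
  have : ∀ v, ∃ e : ι × Bool, D P v ≠ 0 → vt (P e.1) e.2 = v := fun v => by
    by_cases h : D P v ≠ 0
    · obtain ⟨e, he⟩ := D_pos P v h
      exact ⟨e, fun _ => he⟩
    · exact ⟨d, fun h' => absurd h' h⟩
  choose f hf using this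
  exact ⟨f, hf⟩

/-- Adding one edge at `a`. -/
lemma ga [Fintype V] {E : Finset (Sym2 V)} {P : ι → List V} (h : Dec E P) (a : V) (L : Finset V)
    (hL : ∀ x ∈ L, x ≠ a ∧ s(a, x) ∉ E)
    (hz : #(univ.filter (fun v => s(a, v) ∈ E ∧ D P v = 0)) < ∑ x ∈ L, D P x) :
    ∃ x ∈ L, ∃ P' : ι → List V, Dec (insert s(a, x) E) P' ∧ (∀ v, v ≠ a → v ≠ x → D P' v = D P v) ∧
      D P' x + 1 = D P x ∧ D P' a = D P a + 1 := by
  classical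
  set S0 : Finset (ι × Bool) := univ.filter (fun e => vt (P e.1) e.2 ∈ L) with hS0
  have hS0c : #S0 = ∑ x ∈ L, D P x := by
    rw [Finset.card_eq_sum_card_fiberwise (f := fun e => vt (P e.1) e.2) (t := L)]
    · refine Finset.sum_congr rfl fun x hx => ?_
      rw [D_eq]; congr 1; ext e; simp [hS0]; rintro rfl; exact hx
    · intro e he; simpa [hS0] using he
  have hne : S0.Nonempty := by rw [← Finset.card_pos]; omega
  obtain ⟨d, _⟩ := hne
  obtain ⟨asg, hasg⟩ := exists_asg P d
  let Q : Finset (ι × Bool) → Prop := fun C => ∀ e ∈ C, nx a (P e.1) e.2 ≠ a → D P (nx a (P e.1) e.2) ≠ 0 ∧ asg (nx a (P e.1) e.2) ∈ C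
  set G : Finset (ι × Bool) := univ.filter (fun e => ∃ C, Q C ∧ e ∈ C) with hG
  have hQG : Q G := by
    intro e he h'
    obtain ⟨C, hC, heC⟩ := (Finset.mem_filter.1 he).2
    exact ⟨(hC e heC h').1, Finset.mem_filter.2 ⟨by simp, C, hC, (hC e heC h').2⟩⟩
  have hbad : ∀ e ∉ G, nx a (P e.1) e.2 ≠ a ∧ (D P (nx a (P e.1) e.2) ≠ 0 → asg (nx a (P e.1) e.2) ∉ G) := by
    intro e he
    by_contra hcon
    apply he
    refine Finset.mem_filter.2 ⟨by simp, insert e G, ?_, by simp⟩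
    intro f hf hf'
    rcases Finset.mem_insert.1 hf with rfl | hf
    · push Not at hcon
      have := hcon hf'
      exact ⟨this.1, Finset.mem_insert_of_mem this.2⟩
    · exact ⟨(hQG f hf hf').1, Finset.mem_insert_of_mem (hQG f hf hf').2⟩
  have hgood : ∃ e ∈ S0, e ∈ G := by
    by_contra hcon
    push Not at hcon
    have hsub : S0 ⊆ Gᶜ := fun e he => by simpa using hcon e he
    set Z := univ.filter (fun v => s(a, v) ∈ E ∧ D P v = 0) with hZ
    set Y := univ.filter (fun y => D P y ≠ 0 ∧ asg y ∈ Gᶜ \ S0) with hY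
    have c1 : #Gᶜ ≤ #(Z ∪ Y) := by
      apply Finset.card_le_card_of_injOn (fun e => nx a (P e.1) e.2)
      · intro e he
        have he : e ∉ G := by simpa using he
        have h1 := hbad e he
        have h2 := h.nx_mem h1.1
        by_cases h0 : D P (nx a (P e.1) e.2) = 0
        · simp [hZ, h0, h2]
        · simp only [Finset.coe_union, Set.mem_union, Finset.mem_coe]
          right
          rw [hY, Finset.mem_filter]
          refine ⟨by simp, h0, ?_⟩
          rw [Finset.mem_sdiff, Finset.mem_compl]
          refine ⟨h1.2 h0, fun h3 => ?_⟩
          rw [hS0, Finset.mem_filter, hasg _ h0] at h3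
          exact (hL _ h3.2).2 h2
      · intro e he f hf hef
        have he : e ∉ G := by simpa using he
        exact h.nx_inj (hbad e he).1 hef
    have c2 : #Y ≤ #(Gᶜ \ S0) := by
      apply Finset.card_le_card_of_injOn asg
      · intro y hy
        exact (Finset.mem_filter.1 hy).2.2
      · intro y hy z hz hyz
        have h1 := hasg y (Finset.mem_filter.1 hy).2.1
        have h2 := hasg z (Finset.mem_filter.1 hz).2.1
        rw [← h1, ← h2, hyz]
    have c3 := Finset.card_union_le Z Y
    have c4 := Finset.card_sdiff_add_card_eq_card hsub
    omega
  obtain ⟨e0, he0, he0G⟩ := hgood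
  have hx := (Finset.mem_filter.1 he0).2
  obtain ⟨U, hU1, hU2⟩ := bal h a {e0} G (by
      intro e he; rw [Finset.mem_singleton] at he; subst he; exact hL _ hx) asg (by simpa using he0G)
      (fun e he h' => ⟨(hQG e he h').2, hasg _ (hQG e he h').1⟩)
  obtain ⟨K, P', -, k2, k3, k4, k5, k6⟩ := core a P h.nd h.ne U _ hU1 hU2
  have hK : K = ∅ := by
    rw [← Finset.card_eq_zero]; simp at k2; omega
  subst hK
  simp only [Finset.compl_empty, Finset.sum_empty, Finset.card_empty, mul_zero, add_zero, ite_self,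
    Finset.singleton_val, Multiset.map_singleton, Multiset.card_singleton, Multiset.count_singleton] at k5 k6
  refine ⟨_, hx, P', ⟨k3, k4, ?_⟩, ?_, ?_, ?_⟩
  · rw [k5, h.sum, Finset.insert_val_of_notMem (hL _ hx).2, add_comm, Multiset.singleton_add]
  · intro v hv hv'
    have := k6 v
    simp only [hv, hv', if_false, add_zero] at this
    exact this
  · have := k6 (vt (P e0.1) e0.2)
    simp only [(hL _ hx).1, if_true, if_false, add_zero] at this
    exact this
  · have := k6 a
    simp only [(hL _ hx).1.symm, if_true, if_false, add_zero] at this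
    exact this

/-- Adding all edges from `a` to `X`, at the price of some closed paths through `a`. -/
lemma pc [Fintype V] {E : Finset (Sym2 V)} {P : ι → List V} (h : Dec E P) (a : V) (X : Finset V)
    (hX : ∀ x ∈ X, x ≠ a ∧ s(a, x) ∉ E) (hX0 : ∀ x ∈ X, D P x ≠ 0)
    (hN : ∀ x, s(a, x) ∈ E → D P x ≠ 0) :
    ∃ (K : Finset ι) (P' : ι → List V), (∀ i ∈ K, a ∉ P i) ∧ 2 * #K ≤ #X ∧
      (∀ i, (P' i).Nodup) ∧ (∀ i, P' i ≠ []) ∧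
      (∑ i ∈ Kᶜ, ed (P' i) + ∑ i ∈ K, (ed (P i) + {s(a, (P i).headI)} + {s(a, lst (P i))})
        = E.val + (X.image (fun x => s(a, x))).val) ∧
      ∀ v, v ≠ a → v ∉ X → ∑ i ∈ Kᶜ, en (P' i) v = D P v := by
  classical
  rcases X.eq_empty_or_nonempty with rfl | ⟨x0, hx0⟩
  · exact ⟨∅, P, by simp, by simp, h.nd, h.ne, by simp [h.sum], fun v _ _ => by simp [D]⟩
  obtain ⟨d, _⟩ := D_pos P x0 (hX0 x0 hx0)
  obtain ⟨asg, hasg⟩ := exists_asg P d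
  have hinj : Set.InjOn asg X := by
    intro x hx y hy hxy
    rw [← hasg x (hX0 x hx), ← hasg y (hX0 y hy), hxy]
  obtain ⟨U, hU1, hU2⟩ := bal h a (X.image asg) univ (by
    intro e he
    obtain ⟨x, hx, rfl⟩ := Finset.mem_image.1 he
    rw [hasg x (hX0 x hx)]; exact hX x hx) asg (by simp)
    (fun e _ h' => ⟨by simp, hasg _ (hN _ (h.nx_mem h'))⟩)
  have hm : (X.image asg).val.map (fun e => vt (P e.1) e.2) = X.val := by
    rw [Finset.image_val_of_injOn hinj, Multiset.map_map]
    conv_rhs => rw [← Multiset.map_id X.val]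
    exact Multiset.map_congr rfl fun x hx => hasg x (hX0 x hx)
  rw [hm] at hU2
  obtain ⟨K, P', k1, k2, k3, k4, k5, k6⟩ := core a P h.nd h.ne U _ hU1 hU2
  refine ⟨K, P', k1, k2, k3, k4, ?_, ?_⟩
  · rw [k5, h.sum, Finset.image_val_of_injOn]
    intro x _ y _ hxy
    exact Sym2.congr_right.1 hxy
  · intro v hv hvX
    have := k6 v
    simp only [hv, if_false, add_zero] at this
    rw [Multiset.count_eq_zero_of_notMem (by simpa using hvX)] at this
    exact this
end ga


open Finset
set_option linter.unusedSectionVars false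

section cyc
variable {V : Type*} [Inhabited V] [DecidableEq V]

/-- `m` decomposes into `t` paths -/
def Pa (t : ℕ) (m : Multiset (Sym2 V)) : Prop :=
  ∃ Ps : List (List V), Ps.length = t ∧ (∀ Q ∈ Ps, Q.Nodup ∧ Q ≠ []) ∧ (Ps.map ed).sum = m

lemma Pa.add {t t' : ℕ} {m m' : Multiset (Sym2 V)} (h : Pa t m) (h' : Pa t' m') : Pa (t + t') (m + m') := by
  obtain ⟨A, rfl, a2, rfl⟩ := h
  obtain ⟨B, rfl, b2, rfl⟩ := h'
  refine ⟨A ++ B, by simp, ?_, by simp⟩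
  intro Q hQ
  rcases List.mem_append.1 hQ with h | h
  exacts [a2 Q h, b2 Q h]

lemma Pa.one (Q : List V) (h : Q.Nodup) (h' : Q ≠ []) : Pa 1 (ed Q) :=
  ⟨[Q], by simp, by simp [h, h'], by simp⟩

/-- closed path through `b` -/
def cyc (b : V) (L : List V) : Multiset (Sym2 V) := ed L + {s(b, L.headI)} + {s(b, lst L)}

/-- `m` is `t` paths plus an arm at `b` -/
def Arm (b : V) (t : ℕ) (m : Multiset (Sym2 V)) : Prop :=
  ∃ y, y ≠ b ∧ ((∃ m0, Pa t m0 ∧ m0 + {s(b, y)} = m) ∨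
    ∃ z z', z ≠ z' ∧ z ≠ y ∧ z' ≠ y ∧ (∃ m0, Pa t m0 ∧ m0 + {s(b, y)} + {s(y, z)} = m) ∧
      (∃ m0, Pa t m0 ∧ m0 + {s(b, y)} + {s(y, z')} = m))

lemma cyc_eq (b : V) (L : List V) (h : L ≠ []) : cyc b L = ed (b :: L) + {s(b, lst L)} := by
  rw [cyc, ed_cons h]; abel

lemma Arm.ofCyc (b : V) (L : List V) (h : L.Nodup) (hn : L ≠ []) (hb : b ∉ L) : Arm b 1 (cyc b L) := by
  refine ⟨lst L, fun h' => hb (h' ▸ lst_mem hn), Or.inl ⟨ed (b :: L), Pa.one _ (by simp [hb, h]) (by simp), ?_⟩⟩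
  rw [cyc_eq b L hn]

lemma not_nodup_pair (m : Multiset (Sym2 V)) (e : Sym2 V) (h : (m + {e} + {e}).Nodup) : False := by
  rw [add_assoc, Multiset.nodup_add] at h
  have := h.2.1
  simp at this

lemma Arm.ofCyc2 (b : V) (L L' : List V) (h : L.Nodup) (hn : L ≠ []) (hb : b ∉ L)
    (h' : L'.Nodup) (hn' : L' ≠ []) (hb' : b ∉ L') (hm : (cyc b L + cyc b L').Nodup) :
    Arm b 2 (cyc b L + cyc b L') := by
  have p1 : Pa 1 (ed (b :: L)) := Pa.one _ (by simp [hb, h]) (by simp)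
  by_cases hy : lst L ∈ L'
  · have hyb : lst L ≠ b := fun h' => hb (h' ▸ lst_mem hn)
    obtain ⟨l, r, hlr⟩ := List.append_of_mem hy
    rw [hlr] at h' hb'
    have hnd := List.nodup_append.1 h'
    have hnd2 := List.nodup_cons.1 hnd.2.1
    have hly : lst L ∉ l := fun hh => hnd.2.2 _ hh _ (by simp) rfl
    have hcyc : cyc b L' = ed (b :: (l ++ [lst L])) + ed (lst L :: (r ++ [b])) := by
      rw [cyc_eq b L' hn', hlr]
      have : b :: (l ++ lst L :: r) = (b :: l) ++ lst L :: r := rfl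
      rw [this, ed_append]
      have e2 : lst L :: (r ++ [b]) = (lst L :: r) ++ [b] := rfl
      rw [e2, ed_concat (l := lst L :: r) (by simp), lst_append_cons]
      simp only [List.cons_append]
      abel
    refine ⟨lst L, hyb, Or.inr ⟨(r ++ [b]).headI, lst (b :: l), ?_, ?_, ?_, ?_, ?_⟩⟩
    · intro hh
      have q1 : (r ++ [b]).headI ∈ r ++ [b] := headI_mem (by simp)
      have q2 : lst (b :: l) ∈ b :: l := lst_mem (by simp)
      have hdis : ∀ x ∈ l, x ∉ r := fun x hx hx' => hnd.2.2 x hx x (by simp [hx']) rfl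
      have hl0 : l = [] := by
        by_contra h0
        have : lst (b :: l) ∈ l := by rw [lst_cons' _ _ h0]; exact lst_mem h0
        rw [← hh] at this
        rcases List.mem_append.1 q1 with h3 | h3
        · exact hdis _ this h3
        · simp only [List.mem_singleton] at h3
          rw [h3] at this; exact hb' (by simp [this])
      have hr0 : r = [] := by
        by_contra h0
        rw [headI_append h0, hl0, lst_single] at hh
        have := headI_mem h0
        rw [hh] at this; exact hb' (by simp [this])
      subst hl0 hr0
      simp only [List.nil_append] at hlr
      rw [hlr, Multiset.nodup_add] at hm
      have := hm.2.1
      unfold cyc at this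
      simp at this
    · have q1 : (r ++ [b]).headI ∈ r ++ [b] := headI_mem (by simp)
      intro hh; rw [hh] at q1
      simp only [List.mem_append, List.mem_singleton] at q1
      rcases q1 with q1 | q1
      exacts [hnd2.1 q1, hyb q1]
    · have q2 : lst (b :: l) ∈ b :: l := lst_mem (by simp)
      intro hh; rw [hh] at q2
      rcases List.mem_cons.1 q2 with q1 | q1
      exacts [hyb q1, hly q1]
    · refine ⟨ed (b :: L) + ed (r ++ b :: (l ++ [lst L])), p1.add (Pa.one _ ?_ (by simp)), ?_⟩
      · have : List.Perm (r ++ b :: (l ++ [lst L])) (b :: (l ++ lst L :: r)) := by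
          refine List.perm_middle.trans (List.Perm.cons _ ?_)
          refine List.perm_append_comm.trans ?_
          simp
        rw [this.nodup_iff]; simp only [List.nodup_cons]; exact ⟨hb', h'⟩
      · rw [cyc_eq b L hn, hcyc, ed_cons (l := r ++ [b]) (by simp), ed_append r]
        abel
    · refine ⟨ed (b :: L) + ed ((lst L :: r) ++ b :: l), p1.add (Pa.one _ ?_ (by simp)), ?_⟩
      · have : List.Perm ((lst L :: r) ++ b :: l) (b :: (l ++ lst L :: r)) := by
          refine List.perm_middle.trans (List.Perm.cons _ ?_)
          exact List.perm_append_comm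
        rw [this.nodup_iff]; simp only [List.nodup_cons]; exact ⟨hb', h'⟩
      · have e2 : ed (b :: (l ++ [lst L])) = {s(lst L, lst (b :: l))} + ed (b :: l) := by
          rw [← ed_concat (by simp)]; rfl
        rw [cyc_eq b L hn, hcyc, e2, ed_append]
        simp only [List.cons_append]
        abel
  · refine ⟨lst L', fun h'' => hb' (h'' ▸ lst_mem hn'), Or.inl ⟨ed (b :: L) + ed (lst L :: b :: L'), p1.add (Pa.one _ ?_ (by simp)), ?_⟩⟩
    · have : lst L ≠ b := fun h' => hb (h' ▸ lst_mem hn)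
      simp [hb', h', hy, this]
    · rw [cyc_eq b L hn, cyc_eq b L' hn', ed_cons_cons, Sym2.eq_swap (a := lst L)]
      abel

lemma not_nodup_pair' {m : Multiset (Sym2 V)} (h : m.Nodup) (m0 : Multiset (Sym2 V)) (e : Sym2 V) (h' : m = m0 + {e} + {e}) : False :=
  not_nodup_pair m0 e (h' ▸ h)

lemma combine12 {b : V} {t t' : ℕ} {y y' : V} {m0 m1 m1' : Multiset (Sym2 V)} {z z' : V}
    (hy : y ≠ b) (hy' : y' ≠ b) (h0 : Pa t m0) 
    (hzz : z ≠ z') (hz : z ≠ y') (hz' : z' ≠ y') (h1 : Pa t' m1) (h1' : Pa t' m1')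
    (he : m1 + {s(b, y')} + {s(y', z)} = m1' + {s(b, y')} + {s(y', z')})
    (hm : (m0 + {s(b, y)} + (m1 + {s(b, y')} + {s(y', z)})).Nodup) :
    Pa (t + t' + 1) (m0 + {s(b, y)} + (m1 + {s(b, y')} + {s(y', z)})) := by
  have hyy : y ≠ y' := by
    rintro rfl
    exact not_nodup_pair' hm (m0 + m1 + {s(y, z)}) s(b, y) (by abel)
  have key : ∀ w m2, w ≠ y' → w ≠ y → Pa t' m2 → m1 + {s(b, y')} + {s(y', z)} = m2 + {s(b, y')} + {s(y', w)} →
      Pa (t + t' + 1) (m0 + {s(b, y)} + (m1 + {s(b, y')} + {s(y', z)})) := by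
    intro w m2 h3 h4 h5 h6
    rw [h6] at hm ⊢
    have h7 : w ≠ b := by
      rintro rfl
      rw [Sym2.eq_swap (a := y')] at hm
      exact not_nodup_pair' hm (m0 + {s(w, y)} + m2) s(w, y') (by abel)
    have := (h0.add h5).add (Pa.one [w, y', b, y] (by simp [h3, h4, h7, hy', hyy.symm, hy.symm]) (by simp))
    convert this using 1
    simp only [ed_cons_cons, ed_single, Sym2.eq_swap (a := w), Sym2.eq_swap (a := y') (b := b)]
    abel
  by_cases h : z = y
  · exact key z' m1' hz' (fun h' => hzz (h.trans h'.symm)) h1' he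
  · exact key z m1 hz h h1 rfl

lemma Arm.combine {b : V} {t t' : ℕ} {m m' : Multiset (Sym2 V)} (h : Arm b t m) (h' : Arm b t' m')
    (hm : (m + m').Nodup) : Pa (t + t' + 1) (m + m') := by
  obtain ⟨y, hy, h⟩ := h
  obtain ⟨y', hy', h'⟩ := h'
  rcases h with ⟨m0, p0, rfl⟩ | ⟨z, w, hzw, hzy, hwy, ⟨m0, p0, rfl⟩, ⟨m1, p1, e1⟩⟩
  · rcases h' with ⟨n0, q0, rfl⟩ | ⟨z', w', hzw', hzy', hwy', ⟨n0, q0, rfl⟩, ⟨n1, q1, f1⟩⟩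
    · have hyy : y ≠ y' := by
        rintro rfl
        exact not_nodup_pair' hm (m0 + n0) s(b, y) (by abel)
      have := (p0.add q0).add (Pa.one [y, b, y'] (by simp [hyy, hy, hy'.symm]) (by simp))
      convert this using 1
      simp only [ed_cons_cons, ed_single, Sym2.eq_swap (a := y)]
      abel
    · exact combine12 hy hy' p0 hzw' hzy' hwy' q0 q1 f1.symm hm
  · rcases h' with ⟨n0, q0, rfl⟩ | ⟨z', w', hzw', hzy', hwy', ⟨n0, q0, rfl⟩, ⟨n1, q1, f1⟩⟩
    · rw [add_comm _ (n0 + _)] at hm ⊢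
      rw [add_comm t t']
      exact combine12 hy' hy q0 hzw hzy hwy p0 p1 e1.symm hm
    · have hyy : y ≠ y' := by
        rintro rfl
        exact not_nodup_pair' hm (m0 + {s(y, z)} + n0 + {s(y, z')}) s(b, y) (by abel)
      have key : ∀ x x' m2 n2, x ≠ y → x ≠ y' → x' ≠ y → x' ≠ y' → x ≠ x' → Pa t m2 → Pa t' n2 → 
          m0 + {s(b, y)} + {s(y, z)} = m2 + {s(b, y)} + {s(y, x)} →
          n0 + {s(b, y')} + {s(y', z')} = n2 + {s(b, y')} + {s(y', x')} →
          Pa (t + t' + 1) (m0 + {s(b, y)} + {s(y, z)} + (n0 + {s(b, y')} + {s(y', z')})) := by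
        intro x x' m2 n2 g1 g2 g3 g4 g5 g6 g7 g8 g9
        rw [g8, g9] at hm ⊢
        have h7 : x ≠ b := by
          rintro rfl
          rw [Sym2.eq_swap (a := y)] at hm
          exact not_nodup_pair' hm (m2 + (n2 + {s(x, y')} + {s(y', x')})) s(x, y) (by abel)
        have h8 : x' ≠ b := by
          rintro rfl
          rw [Sym2.eq_swap (a := y')] at hm
          exact not_nodup_pair' hm (m2 + {s(x', y)} + {s(y, x)} + n2) s(x', y') (by abel)
        have := (g6.add g7).add (Pa.one [x, y, b, y', x'] (by
          simp [g1, g2, g3.symm, g4.symm, g5, h7, h8.symm, hy, hy'.symm, hyy]) (by simp))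
        convert this using 1
        simp only [ed_cons_cons, ed_single, Sym2.eq_swap (a := x), Sym2.eq_swap (a := y) (b := b)]
        abel
      have hor : ∀ x x' m2 n2, 
          m0 + {s(b, y)} + {s(y, z)} = m2 + {s(b, y)} + {s(y, x)} →
          n0 + {s(b, y')} + {s(y', z')} = n2 + {s(b, y')} + {s(y', x')} → x = y' → x' = y → False := by
        rintro x x' m2 n2 g8 g9 rfl rfl
        rw [g8, g9, Sym2.eq_swap (a := x')] at hm
        exact not_nodup_pair' hm (m2 + {s(b, x')} + n2 + {s(b, x)}) s(x, x') (by abel)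
      by_cases hA : z ≠ y' ∧ w ≠ y'
      · have fin : ∀ x' n2, x' ≠ y → x' ≠ y' → Pa t' n2 →
            n0 + {s(b, y')} + {s(y', z')} = n2 + {s(b, y')} + {s(y', x')} →
            Pa (t + t' + 1) (m0 + {s(b, y)} + {s(y, z)} + (n0 + {s(b, y')} + {s(y', z')})) := by
          intro x' n2 g1 g2 g3 g4
          by_cases hx : z = x'
          · exact key w x' m1 n2 hwy hA.2 g1 g2 (fun h => hzw (hx.trans h.symm)) p1 g3 e1.symm g4
          · exact key z x' m0 n2 hzy hA.1 g1 g2 hx p0 g3 rfl g4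
        by_cases hx : z' = y
        · exact fin w' n1 (fun h => hzw' (hx.trans h.symm)) hwy' q1 f1.symm
        · exact fin z' n0 hx hzy' q0 rfl
      · have hB : z' ≠ y ∧ w' ≠ y := by
          rw [not_and_or, not_not, not_not] at hA
          rcases hA with hA | hA
          · exact ⟨hor z z' m0 n0 rfl rfl hA, hor z w' m0 n1 rfl f1.symm hA⟩
          · exact ⟨hor w z' m1 n0 e1.symm rfl hA, hor w w' m1 n1 e1.symm f1.symm hA⟩
        have fin : ∀ x m2, x ≠ y → x ≠ y' → Pa t m2 →
            m0 + {s(b, y)} + {s(y, z)} = m2 + {s(b, y)} + {s(y, x)} →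
            Pa (t + t' + 1) (m0 + {s(b, y)} + {s(y, z)} + (n0 + {s(b, y')} + {s(y', z')})) := by
          intro x m2 g1 g2 g3 g4
          by_cases hx : x = z'
          · exact key x w' m2 n1 g1 g2 hB.2 hwy' (fun h => hzw' (hx.symm.trans h)) g3 q1 g4 f1.symm
          · exact key x z' m2 n0 g1 g2 hB.1 hzy' hx g3 q0 g4 rfl
        by_cases hx : z = y'
        · exact fin w m1 hwy (fun h => hzw (hx.trans h.symm)) p1 e1.symm
        · exact fin z m0 hzy hx p0 rfl

lemma cycles (b : V) : ∀ Ls : List (List V), (∀ L ∈ Ls, L.Nodup ∧ L ≠ [] ∧ b ∉ L) →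
    ((Ls.map (cyc b)).sum).Nodup → ∃ t, t ≤ Ls.length + (Ls.length + 3) / 4 ∧ Pa t (Ls.map (cyc b)).sum
  | [], _, _ => ⟨0, by simp, [], by simp⟩
  | [A], h, hm => by
      refine ⟨2, by simp, ?_⟩
      have hA := h A (by simp)
      have hy : lst A ≠ b := fun h' => hA.2.2 (h' ▸ lst_mem hA.2.1)
      have := (Pa.one (b :: A) (by simp [hA]) (by simp)).add (Pa.one [b, lst A] (by simp [hy.symm]) (by simp))
      simpa [cyc_eq b A hA.2.1] using this
  | [A, B], h, hm => by
      refine ⟨3, by simp, ?_⟩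
      have hA := h A (by simp)
      have hB := h B (by simp)
      simp only [List.map_cons, List.map_nil, List.sum_cons, List.sum_nil, add_zero] at hm ⊢
      exact (Arm.ofCyc b A hA.1 hA.2.1 hA.2.2).combine (Arm.ofCyc b B hB.1 hB.2.1 hB.2.2) hm
  | [A, B, C], h, hm => by
      refine ⟨4, by simp, ?_⟩
      have hA := h A (by simp)
      have hB := h B (by simp)
      have hC := h C (by simp)
      simp only [List.map_cons, List.map_nil, List.sum_cons, List.sum_nil, add_zero] at hm ⊢
      have hBC := (Multiset.nodup_add.1 hm).2.1
      exact (Arm.ofCyc b A hA.1 hA.2.1 hA.2.2).combine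
        (Arm.ofCyc2 b B C hB.1 hB.2.1 hB.2.2 hC.1 hC.2.1 hC.2.2 hBC) hm
  | A :: B :: C :: E :: Ls, h, hm => by
      have hA := h A (by simp)
      have hB := h B (by simp)
      have hC := h C (by simp)
      have hE := h E (by simp)
      simp only [List.map_cons, List.sum_cons, ← add_assoc] at hm ⊢
      have h1 := (Multiset.nodup_add.1 hm)
      obtain ⟨t, ht, hp⟩ := cycles b Ls (fun L hL => h L (by simp [hL])) h1.2.1
      have h2 : (cyc b A + cyc b B + (cyc b C + cyc b E)).Nodup := by
        rw [← add_assoc]; exact h1.1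
      have h3 := Multiset.nodup_add.1 h2
      have := (Arm.ofCyc2 b A B hA.1 hA.2.1 hA.2.2 hB.1 hB.2.1 hB.2.2 h3.1).combine
        (Arm.ofCyc2 b C E hC.1 hC.2.1 hC.2.2 hE.1 hE.2.1 hE.2.2 h3.2.1) h2
      refine ⟨2 + 2 + 1 + t, by simp only [List.length_cons]; omega, ?_⟩
      rw [add_assoc (cyc b A + cyc b B)]
      exact this.add hp
end cyc


open Finset
set_option linter.unusedSectionVars false

section phase
variable {V : Type*} [Inhabited V] [DecidableEq V] [Fintype V]

/-- degree -/
def dg (E : Finset (Sym2 V)) (v : V) : ℕ := #(E.filter (fun e => v ∈ e))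

lemma Dec.par {ι : Type} [Fintype ι] {E : Finset (Sym2 V)} {P : ι → List V} (h : Dec E P) (v : V) :
    Even (dg E v + D P v) := by
  have h1 : dg E v = E.val.countP (fun e => v ∈ e) := by
    rw [Multiset.countP_eq_card_filter]; rfl
  have h2 : E.val.countP (fun e => v ∈ e) = ∑ i, (ed (P i)).countP (fun e => v ∈ e) := by
    rw [← h.sum]
    exact map_sum (Multiset.countPAddMonoidHom (fun e : Sym2 V => v ∈ e)) _ _
  rw [h1, h2, D, ← Finset.sum_add_distrib]
  apply Finset.even_sum
  intro i _
  rw [ed_parity (P i) (h.nd i) (h.ne i)]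
  exact even_two_mul _

lemma sum_dg (E : Finset (Sym2 V)) (hE : ∀ e ∈ E, ¬ e.IsDiag) : ∑ v, dg E v = 2 * #E := by
  unfold dg
  simp only [Finset.card_filter]
  rw [Finset.sum_comm]
  rw [mul_comm, ← smul_eq_mul, ← Finset.sum_const]
  refine Finset.sum_congr rfl fun e he => ?_
  rw [← Finset.card_filter]
  have := Sym2.card_toFinset_of_not_isDiag e (hE e he)
  rw [← this]
  congr 1; ext; simp

lemma even_odd (E : Finset (Sym2 V)) (hE : ∀ e ∈ E, ¬ e.IsDiag) : Even #(univ.filter (fun v => Odd (dg E v))) := by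
  have := sum_dg E hE
  rw [← Finset.even_sum_iff_even_card_odd]
  rw [this]; exact even_two_mul _

/-- the star with center `b` and leaves `X` -/
def star' (b : V) (X : Finset V) : Finset (Sym2 V) := X.image (fun x => s(b, x))

lemma mem_star' {b : V} {X : Finset V} {v : V} : s(b, v) ∈ star' b X ↔ v ∈ X := by
  unfold star'
  rw [Finset.mem_image]
  constructor
  · rintro ⟨x, hx, h⟩; rw [Sym2.congr_right] at h; exact h ▸ hx
  · intro h; exact ⟨v, h, rfl⟩

lemma mem_star'' {b : V} {X : Finset V} {x v : V} (h : s(x, v) ∈ star' b X) : (x = b ∧ v ∈ X) ∨ (v = b ∧ x ∈ X) := by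
  unfold star' at h
  obtain ⟨y, hy, h⟩ := Finset.mem_image.1 h
  rw [Sym2.eq_iff] at h
  rcases h with ⟨rfl, rfl⟩ | ⟨rfl, rfl⟩
  · exact Or.inl ⟨rfl, hy⟩
  · exact Or.inr ⟨rfl, hy⟩

lemma star'_sub {b : V} {X : Finset V} {E : Finset (Sym2 V)} (h : ∀ x ∈ X, s(b, x) ∈ E) : star' b X ⊆ E := by
  intro e he
  obtain ⟨x, hx, rfl⟩ := Finset.mem_image.1 he
  exact h x hx

lemma dg_star (E : Finset (Sym2 V)) (b : V) (X : Finset V) (h : ∀ x ∈ X, x ≠ b ∧ s(b, x) ∈ E) (v : V) :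
    dg (E \ star' b X) v + (if v = b then #X else if v ∈ X then 1 else 0) = dg E v := by
  have hsub := star'_sub (fun x hx => (h x hx).2)
  have h1 : #((star' b X).filter (fun e => v ∈ e)) = (if v = b then #X else if v ∈ X then 1 else 0) := by
    split_ifs with h1 h2
    · subst h1
      rw [Finset.filter_true_of_mem]
      · unfold star'
        apply Finset.card_image_of_injective
        intro x y hxy; exact Sym2.congr_right.1 hxy
      · intro e he
        obtain ⟨x, hx, rfl⟩ := Finset.mem_image.1 he
        simp
    · rw [Finset.card_eq_one]
      refine ⟨s(b, v), ?_⟩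
      ext e
      simp only [Finset.mem_filter, Finset.mem_singleton]
      constructor
      · rintro ⟨he, hv⟩
        obtain ⟨x, hx, rfl⟩ := Finset.mem_image.1 he
        rw [Sym2.mem_iff] at hv
        rcases hv with rfl | rfl
        · exact absurd rfl h1
        · rfl
      · rintro rfl
        exact ⟨mem_star'.2 h2, by simp⟩
    · rw [Finset.card_eq_zero]
      ext e
      simp only [Finset.mem_filter, Finset.notMem_empty, iff_false]
      rintro ⟨he, hv⟩
      obtain ⟨x, hx, rfl⟩ := Finset.mem_image.1 he
      rw [Sym2.mem_iff] at hv
      rcases hv with rfl | rfl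
      · exact absurd rfl h1
      · exact h2 hx
  rw [← h1]
  unfold dg
  rw [← Finset.card_union_of_disjoint, ← Finset.filter_union, Finset.sdiff_union_of_subset hsub]
  exact Finset.disjoint_filter_filter Finset.sdiff_disjoint

variable {ι : Type} [Fintype ι]

lemma phase1 {H : Finset (Sym2 V)} {P : ι → List V} (h : Dec H P) (b : V) (L0 : Finset V)
    (hL : ∀ x ∈ L0, x ≠ b ∧ s(b, x) ∉ H ∧ D P x ≠ 0) (hN : ∀ v, s(b, v) ∈ H → D P v ≠ 0) :
    ∀ j, 2 * j ≤ #L0 + 1 → ∃ B ⊆ L0, #B = j ∧ ∃ P' : ι → List V, Dec (H ∪ star' b B) P' ∧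
      (∀ v, v ≠ b → v ∉ B → D P' v = D P v) ∧ D P' b = D P b + j := by
  classical
  intro j
  induction j with
  | zero => exact fun _ => ⟨∅, by simp, by simp, P, by simpa [star'] using h, fun v _ _ => rfl, by simp⟩
  | succ j ih =>
    intro hj
    obtain ⟨B, hB, hBc, P', h1, h2, h3⟩ := ih (by omega)
    have hsd := Finset.card_sdiff_add_card_eq_card hB
    obtain ⟨x, hx, P'', g1, g2, g3, g4⟩ := ga h1 b (L0 \ B) (by
      intro x hx
      rw [Finset.mem_sdiff] at hx
      have := hL x hx.1
      refine ⟨this.1, ?_⟩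
      rw [Finset.mem_union, mem_star']
      exact fun h' => h'.elim this.2.1 hx.2) (by
      have c1 : #(L0 \ B) ≤ ∑ x ∈ L0 \ B, D P' x := by
        rw [Finset.card_eq_sum_ones]
        apply Finset.sum_le_sum
        intro x hx
        rw [Finset.mem_sdiff] at hx
        have := hL x hx.1
        rw [h2 x this.1 hx.2]
        exact Nat.one_le_iff_ne_zero.2 this.2.2
      have c2 : #(univ.filter (fun v => s(b, v) ∈ H ∪ star' b B ∧ D P' v = 0)) ≤ #B := by
        apply Finset.card_le_card
        intro v hv
        simp only [Finset.mem_filter, Finset.mem_univ, true_and, Finset.mem_union, mem_star'] at hv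
        by_contra hvB
        have hH : s(b, v) ∈ H := hv.1.resolve_right hvB
        by_cases hvb : v = b
        · subst hvb
          have := hN v hH
          omega
        · have := h2 v hvb hvB
          have := hN v hH
          omega
      omega)
    rw [Finset.mem_sdiff] at hx
    have hxb := (hL x hx.1).1
    refine ⟨insert x B, Finset.insert_subset hx.1 hB, by rw [Finset.card_insert_of_notMem hx.2, hBc], P'', ?_, ?_, by omega⟩
    · convert g1 using 1
      unfold star'
      rw [Finset.image_insert]
      simp
    · intro v hvb hv
      rw [Finset.mem_insert, not_or] at hv
      rw [g2 v hvb hv.1, h2 v hvb hv.2]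

/-- adding the edge `xb` with center `x` -/
lemma left1 {E : Finset (Sym2 V)} {P : ι → List V} (h : Dec E P) (b x : V) (hx : x ≠ b) (hE : s(b, x) ∉ E)
    (hz : #(univ.filter (fun v => s(x, v) ∈ E ∧ D P v = 0)) < D P b) :
    ∃ P' : ι → List V, Dec (insert s(b, x) E) P' ∧
      (∀ v, v ≠ b → v ≠ x → D P' v = D P v) ∧ D P' b + 1 = D P b ∧ D P' x = D P x + 1 := by
  classical
  obtain ⟨y, hy, P', h1, h2, h3, h4⟩ := ga h x {b} (by
    intro y hy; rw [Finset.mem_singleton] at hy; subst hy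
    exact ⟨hx.symm, by rwa [Sym2.eq_swap]⟩) (by simpa using hz)
  rw [Finset.mem_singleton] at hy; subst hy
  refine ⟨P', by rwa [Sym2.eq_swap], fun v a b => h2 v b a, h3, h4⟩

lemma leftovers {E : Finset (Sym2 V)} {P : ι → List V} (h : Dec E P) (b : V) (R : Finset V)
    (hR : ∀ x ∈ R, x ≠ b ∧ s(b, x) ∉ E) (hN : ∀ x ∈ R, ∀ v, s(x, v) ∈ E → D P v ≠ 0) (hb : #R ≤ D P b) :
    ∃ P' : ι → List V, Dec (E ∪ star' b R) P' ∧
      (∀ v, v ≠ b → v ∉ R → D P' v = D P v) ∧ D P' b + #R = D P b ∧ ∀ v, v ≠ b → D P v ≤ D P' v := by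
  classical
  induction R using Finset.induction_on with
  | empty => exact ⟨P, by simpa [star'] using h, fun _ _ _ => rfl, by simp, fun _ _ => le_rfl⟩
  | insert x R hxR ih =>
    rw [Finset.card_insert_of_notMem hxR] at hb
    obtain ⟨P', h1, h2, h3, h4⟩ := ih (fun y hy => hR y (by simp [hy])) (fun y hy => hN y (by simp [hy])) (by omega)
    have hx := hR x (by simp)
    obtain ⟨P'', g1, g2, g3, g4⟩ := left1 h1 b x hx.1 (by
      rw [Finset.mem_union, mem_star']
      exact fun h' => h'.elim hx.2 hxR) (by
      have : univ.filter (fun v => s(x, v) ∈ E ∪ star' b R ∧ D P' v = 0) = ∅ := by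
        ext v
        simp only [Finset.mem_filter, Finset.mem_univ, true_and, Finset.notMem_empty, iff_false, Finset.mem_union]
        rintro ⟨h5 | h5, h6⟩
        · have h7 := hN x (by simp) v h5
          have hvb : v ≠ b := by rintro rfl; exact hx.2 (by rwa [Sym2.eq_swap])
          have := h4 v hvb
          omega
        · rcases mem_star'' h5 with h7 | h7
          · exact hx.1 h7.1
          · exact hxR h7.2
      rw [this, Finset.card_empty]; omega)
    refine ⟨P'', ?_, ?_, by rw [Finset.card_insert_of_notMem hxR]; omega, ?_⟩
    · convert g1 using 1
      unfold star'
      rw [Finset.image_insert]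
      simp
    · intro v hvb hv
      rw [Finset.mem_insert, not_or] at hv
      rw [g2 v hvb hv.1, h2 v hvb hv.2]
    · intro v hvb
      have := h4 v hvb
      by_cases hvx : v = x
      · subst hvx; omega
      · rw [g2 v hvb hvx]; exact this

/-- weight of a vertex -/
def wt (E : Finset (Sym2 V)) (S : Finset V) (v : V) : ℕ :=
  if Odd (dg E v) then 3 else if v ∈ S then 6 else if dg E v = 0 then 0 else 4

/-- the induction statement -/
def Claim (E : Finset (Sym2 V)) (S : Finset V) : Prop :=
  ∃ (ι : Type) (_ : Fintype ι) (P : ι → List V), Dec E P ∧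
    (∀ v ∈ S, Even (dg E v) → 2 ≤ D P v) ∧ 6 * Fintype.card ι ≤ ∑ v, wt E S v

end phase


open Finset
set_option linter.unusedSectionVars false

section cases
variable {V : Type*} [Inhabited V] [DecidableEq V] [Fintype V]

lemma Dec.odd_pos {ι : Type} [Fintype ι] {E : Finset (Sym2 V)} {P : ι → List V} (h : Dec E P) {v : V}
    (hv : Odd (dg E v)) : D P v ≠ 0 := by
  intro h0
  have := h.par v
  rw [h0, add_zero] at this
  exact (Nat.not_even_iff_odd.2 hv) this

lemma dg_ne_zero {E : Finset (Sym2 V)} {x v : V} (h : s(x, v) ∈ E) : dg E v ≠ 0 := by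
  unfold dg
  rw [Finset.card_ne_zero]
  exact ⟨s(x, v), Finset.mem_filter.2 ⟨h, by simp⟩⟩

lemma wt_le_six (E : Finset (Sym2 V)) (S : Finset V) (v : V) : wt E S v ≤ 6 := by
  unfold wt; split_ifs <;> omega

lemma claim_empty (S : Finset V) : Claim (∅ : Finset (Sym2 V)) S := by
  refine ⟨Fin #S, inferInstance, fun i => [(S.equivFin.symm i : V)], ⟨by simp, by simp, by simp⟩, ?_, ?_⟩
  · intro v hv _
    have : en [(S.equivFin.symm (S.equivFin ⟨v, hv⟩) : V)] v ≤ D (fun i => [(S.equivFin.symm i : V)]) v :=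
      Finset.single_le_sum (f := fun i => en [(S.equivFin.symm i : V)] v) (fun _ _ => Nat.zero_le _) (Finset.mem_univ _)
    simpa [en] using this
  · have : ∀ v, wt (∅ : Finset (Sym2 V)) S v = if v ∈ S then 6 else 0 := by
      intro v; simp [wt, dg]
    simp only [this]
    rw [← Finset.sum_filter, Finset.sum_const]
    simp [mul_comm]

lemma nodiag_ne {E : Finset (Sym2 V)} (hE : ∀ e ∈ E, ¬ e.IsDiag) {x v : V} (h : s(x, v) ∈ E) : x ≠ v := by
  have := hE _ h
  simpa using this

lemma case0_even {E : Finset (Sym2 V)} (hE : ∀ e ∈ E, ¬ e.IsDiag) (S : Finset V)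
    (ih : ∀ E' S', E' ⊂ E → Claim (V := V) E' S') (a b : V) (hab : s(b, a) ∈ E)
    (ha : Even (dg E a)) (hb : Even (dg E b)) (haS : a ∈ S) (hbS : b ∈ S) : Claim E S := by
  classical
  have hne := nodiag_ne hE hab
  have hst : ∀ x ∈ ({a} : Finset V), x ≠ b ∧ s(b, x) ∈ E := by simp [hab, hne.symm]
  have hsub := star'_sub (fun x hx => (hst x hx).2)
  have hdg := dg_star E b {a} hst
  have hss : E \ star' b {a} ⊂ E := Finset.sdiff_ssubset hsub ⟨s(b, a), mem_star'.2 (by simp)⟩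
  obtain ⟨ι, _, P, h1, h2, h3⟩ := ih _ S hss
  have hda := hdg a
  have hdb := hdg b
  simp only [hne.symm, if_true, if_false, Finset.mem_singleton, Finset.card_singleton] at hda hdb
  rw [← hda, Nat.even_add_one, Nat.not_even_iff_odd] at ha
  rw [← hdb, Nat.even_add_one, Nat.not_even_iff_odd] at hb
  have hD : ∀ v, D (fun o : Option ι => o.elim [b, a] P) v = en [b, a] v + D P v := by
    intro v
    unfold D
    rw [Fintype.sum_option]; rfl
  refine ⟨Option ι, inferInstance, fun o => o.elim [b, a] P, ⟨?_, ?_, ?_⟩, ?_, ?_⟩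
  · rintro (_ | i)
    · simp [hne]
    · exact h1.nd i
  · rintro (_ | i)
    · simp
    · exact h1.ne i
  · rw [Fintype.sum_option]
    simp only [Option.elim]
    rw [h1.sum]
    have : ed [b, a] = (star' b {a}).val := by simp [star']
    rw [this, add_comm, ← Finset.disjUnion_val _ _ Finset.sdiff_disjoint, Finset.disjUnion_eq_union,
      Finset.sdiff_union_of_subset hsub]
  · intro v hv hev
    rw [hD]
    by_cases hva : v = a
    · subst hva
      have := h1.odd_pos ha
      simp [en, hne]; omega
    · by_cases hvb : v = b
      · subst hvb
        have := h1.odd_pos hb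
        simp [en, hne.symm]; omega
      · have := hdg v
        simp only [hva, hvb, if_false, Finset.mem_singleton, add_zero] at this
        have := h2 v hv (this ▸ hev)
        omega
  · rw [Fintype.card_option, mul_add]
    have key : ∀ v, wt (E \ star' b {a}) S v + (if v = a then 3 else 0) + (if v = b then 3 else 0) ≤ wt E S v := by
      intro v
      by_cases hva : v = a
      · subst hva
        have q : ¬ Odd (dg E v) := by
          rw [← hda, Nat.not_odd_iff_even, Nat.even_add_one, Nat.not_even_iff_odd]; exact ha
        simp [wt, ha, haS, hne.symm, q]
      · by_cases hvb : v = b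
        · subst hvb
          have q : ¬ Odd (dg E v) := by
            rw [← hdb, Nat.not_odd_iff_even, Nat.even_add_one, Nat.not_even_iff_odd]; exact hb
          simp [wt, hb, hbS, hne, q]
        · have := hdg v
          simp only [hva, hvb, if_false, Finset.mem_singleton, add_zero] at this
          simp [wt, this, hva, hvb]
    have := Finset.sum_le_sum (fun v (_ : v ∈ (univ : Finset V)) => key v)
    rw [Finset.sum_add_distrib, Finset.sum_add_distrib] at this
    simp only [Finset.sum_ite_eq', Finset.mem_univ, if_true] at this
    omega

lemma case0_odd {E : Finset (Sym2 V)} (hE : ∀ e ∈ E, ¬ e.IsDiag) (S : Finset V)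
    (ih : ∀ E' S', E' ⊂ E → Claim (V := V) E' S') (hF : ∀ v, Odd (dg E v) ∨ v ∈ S ∨ dg E v = 0)
    (a b : V) (hab : s(b, a) ∈ E) (hb : Odd (dg E b)) : Claim E S := by
  classical
  have hne := nodiag_ne hE hab
  have hst : ∀ x ∈ ({a} : Finset V), x ≠ b ∧ s(b, x) ∈ E := by simp [hab, hne.symm]
  have hsub := star'_sub (fun x hx => (hst x hx).2)
  have hdg := dg_star E b {a} hst
  have hss : E \ star' b {a} ⊂ E := Finset.sdiff_ssubset hsub ⟨s(b, a), mem_star'.2 (by simp)⟩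
  obtain ⟨ι, _, P, h1, h2, h3⟩ := ih _ (insert b (S.erase a)) hss
  have hda := hdg a
  have hdb := hdg b
  simp only [hne.symm, if_true, if_false, Finset.mem_singleton, Finset.card_singleton] at hda hdb
  have hbe : Even (dg (E \ star' b {a}) b) := by
    rw [← hdb, Nat.odd_add_one, Nat.not_odd_iff_even] at hb
    exact hb
  have hDb := h2 b (by simp) hbe
  have hz : univ.filter (fun v => s(a, v) ∈ E \ star' b {a} ∧ D P v = 0) = ∅ := by
    ext v
    simp only [Finset.mem_filter, Finset.mem_univ, true_and, Finset.notMem_empty, iff_false]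
    rintro ⟨h5, h6⟩
    have h7 := Finset.mem_sdiff.1 h5
    have hva := (nodiag_ne hE h7.1).symm
    have hvb : v ≠ b := by
      rintro rfl; apply h7.2; rw [Sym2.eq_swap]; exact mem_star'.2 (by simp)
    have hd := hdg v
    simp only [hva, hvb, if_false, Finset.mem_singleton, add_zero] at hd
    rcases hF v with h | h | h
    · rw [← hd] at h; exact h1.odd_pos h h6
    · by_cases ho : Odd (dg (E \ star' b {a}) v)
      · exact h1.odd_pos ho h6
      · have := h2 v (by simp [hva, h]) (Nat.not_odd_iff_even.1 ho)
        omega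
    · exact dg_ne_zero h7.1 h
  obtain ⟨P', g1, g2, g3, g4⟩ := left1 h1 b a hne.symm (by
    rw [Finset.mem_sdiff]; exact fun h => h.2 (mem_star'.2 (by simp))) (by rw [hz, Finset.card_empty]; omega)
  refine ⟨ι, inferInstance, P', ?_, ?_, ?_⟩
  · convert g1 using 1
    rw [Finset.insert_eq]
    have : ({s(b, a)} : Finset (Sym2 V)) = star' b {a} := by simp [star']
    rw [this, Finset.union_sdiff_of_subset hsub]
  · intro v hv hev
    have hvb : v ≠ b := by rintro rfl; exact (Nat.not_even_iff_odd.2 hb) hev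
    by_cases hva : v = a
    · subst hva
      rw [← hda, Nat.even_add_one, Nat.not_even_iff_odd] at hev
      have := h1.odd_pos hev
      omega
    · have hd := hdg v
      simp only [hva, hvb, if_false, Finset.mem_singleton, add_zero] at hd
      rw [g2 v hvb hva]
      exact h2 v (by simp [hva, hv]) (hd ▸ hev)
  · have key : ∀ v, wt (E \ star' b {a}) (insert b (S.erase a)) v ≤ wt E S v + (if v = a then 1 else 0) + (if v = b then 3 else 0) := by
      intro v
      by_cases hva : v = a
      · subst hva
        have hdz := dg_ne_zero hab
        have : v ∉ insert b (S.erase v) := by simp [hne.symm]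
        simp only [wt, this, if_false, if_true, hne.symm]
        split_ifs <;> omega
      · by_cases hvb : v = b
        · subst hvb
          have := wt_le_six (E \ star' v {a}) (insert v (S.erase a)) v
          have q : wt E S v = 3 := by simp [wt, hb]
          simp only [hne, if_true, if_false]
          omega
        · have := hdg v
          simp only [hva, hvb, if_false, Finset.mem_singleton, add_zero] at this
          simp [wt, this, hva, hvb]
    have := Finset.sum_le_sum (fun v (_ : v ∈ (univ : Finset V)) => key v)
    rw [Finset.sum_add_distrib, Finset.sum_add_distrib] at this
    simp only [Finset.sum_ite_eq', Finset.mem_univ, if_true] at this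
    have hdvd : 6 ∣ ∑ v, wt E S v := by
      have hw : ∀ v, wt E S v = 3 * (if Odd (dg E v) then 1 else 0) + 6 * (if ¬ Odd (dg E v) ∧ v ∈ S then 1 else 0) := by
        intro v
        unfold wt
        rcases hF v with h | h | h <;> split_ifs <;> simp_all
      simp only [hw]
      rw [Finset.sum_add_distrib, ← Finset.mul_sum, ← Finset.mul_sum, ← Finset.card_filter]
      obtain ⟨k, hk⟩ := even_odd E hE
      rw [hk]
      exact dvd_add ⟨k, by ring⟩ (dvd_mul_right _ _)
    omega
end cases


open Finset
set_option linter.unusedSectionVars false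

section casesI
variable {V : Type*} [Inhabited V] [DecidableEq V] [Fintype V]

/-- the free vertices -/
def inF (E : Finset (Sym2 V)) (S : Finset V) (v : V) : Prop := Even (dg E v) ∧ v ∉ S ∧ dg E v ≠ 0

instance (E : Finset (Sym2 V)) (S : Finset V) (v : V) : Decidable (inF E S v) := by
  unfold inF; infer_instance

/-- free neighbours -/
def NF (E : Finset (Sym2 V)) (S : Finset V) (b : V) : Finset V :=
  univ.filter (fun v => inF E S v ∧ s(b, v) ∈ E)

lemma mem_NF {E : Finset (Sym2 V)} {S : Finset V} {b v : V} : v ∈ NF E S b ↔ inF E S v ∧ s(b, v) ∈ E := by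
  simp [NF]

lemma weightI {E : Finset (Sym2 V)} {S T X : Finset V} {b : V} (hb : inF E S b) (hT : ∀ v ∈ T, inF E S v)
    (hX : ∀ x ∈ X, x ≠ b ∧ s(b, x) ∈ E) (hXF : ∀ x ∈ X, inF E S x) :
    ∑ v, wt (E \ star' b X) (S ∪ T) v + #X + #X % 2 ≤ ∑ v, wt E S v + 2 * #T := by
  have hdg := dg_star E b X hX
  have hF : ∀ v, inF E S v → wt E S v = 4 := by
    intro v hv
    simp [wt, Nat.not_odd_iff_even.2 hv.1, hv.2.1, hv.2.2]
  have key : ∀ v, wt (E \ star' b X) (S ∪ T) v + (if v ∈ X then 1 else 0) + (if v = b then #X % 2 else 0) ≤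
      wt E S v + 2 * (if v ∈ T then 1 else 0) := by
    intro v
    have hd := hdg v
    by_cases hvb : v = b
    · subst hvb
      have hvX : v ∉ X := fun h => (hX v h).1 rfl
      rw [hF v hb]
      simp only [if_true, hvX, if_false] at hd ⊢
      have he := hb.1
      rw [← hd] at he
      unfold wt
      by_cases ho : Odd #X
      · have : Odd (dg (E \ star' v X) v) := by
          by_contra h
          rw [Nat.not_odd_iff_even] at h
          exact (Nat.not_even_iff_odd.2 ho) ((Nat.even_add.1 he).1 h)
        rw [if_pos this]
        rw [Nat.odd_iff] at ho
        omega
      · have : ¬ Odd (dg (E \ star' v X) v) := by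
          rw [Nat.not_odd_iff_even] at ho ⊢
          exact (Nat.even_add.1 he).2 ho
        rw [if_neg this]
        rw [Nat.not_odd_iff_even, Nat.even_iff] at ho
        have hS := hb.2.1
        by_cases hvT : v ∈ T
        · simp [hvT, ho]
        · simp only [Finset.mem_union, hS, hvT, or_self, if_false, ho]
          split_ifs <;> omega
    · by_cases hvX : v ∈ X
      · rw [hF v (hXF v hvX)]
        simp only [hvb, hvX, if_true, if_false] at hd ⊢
        have he := (hXF v hvX).1
        rw [← hd, Nat.even_add_one, Nat.not_even_iff_odd] at he
        simp [wt, he]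
      · simp only [hvb, hvX, if_false, add_zero] at hd ⊢
        by_cases hvT : v ∈ T
        · have := wt_le_six (E \ star' b X) (S ∪ T) v
          rw [hF v (hT v hvT)]
          simp only [hvT, if_true]; omega
        · simp [wt, hvT, hd]
  have := Finset.sum_le_sum (fun v (_ : v ∈ (univ : Finset V)) => key v)
  rw [Finset.sum_add_distrib, Finset.sum_add_distrib, Finset.sum_add_distrib, ← Finset.mul_sum] at this
  simp only [Finset.sum_ite_eq', Finset.mem_univ, if_true] at this
  rw [← Finset.card_filter, ← Finset.card_filter] at this
  simpa using this

/-- facts available after removing a star from a free vertex -/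
structure StI (E : Finset (Sym2 V)) (S T X : Finset V) (b : V) {ι : Type} [Fintype ι] (P : ι → List V) : Prop where
  dec : Dec (E \ star' b X) P
  X0 : ∀ x ∈ X, D P x ≠ 0
  nF : ∀ v, v ∉ X → v ≠ b → ¬ inF E S v → dg E v ≠ 0 → D P v ≠ 0
  T2 : ∀ v ∈ T, v ∉ X → v ≠ b → 2 ≤ D P v
  b1 : Odd #X → D P b ≠ 0
  b2 : b ∈ T → Even #X → 2 ≤ D P b
  S2 : ∀ v ∈ S, Even (dg E v) → v ≠ b ∧ v ∉ X ∧ 2 ≤ D P v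
  W : 6 * Fintype.card ι + #X + #X % 2 ≤ ∑ v, wt E S v + 2 * #T

lemma setupI {E : Finset (Sym2 V)} {S T X : Finset V} {b : V}
    (ih : ∀ E' S', E' ⊂ E → Claim (V := V) E' S') (hb : inF E S b) (hT : ∀ v ∈ T, inF E S v)
    (hX : ∀ x ∈ X, x ≠ b ∧ s(b, x) ∈ E) (hXF : ∀ x ∈ X, inF E S x) (hXn : X.Nonempty) :
    ∃ (ι : Type) (_ : Fintype ι) (P : ι → List V), StI E S T X b P := by
  have hdg := dg_star E b X hX
  have hw := weightI hb hT hX hXF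
  have hsub := star'_sub (fun x hx => (hX x hx).2)
  obtain ⟨x0, hx0⟩ := hXn
  have hss : E \ star' b X ⊂ E := Finset.sdiff_ssubset hsub ⟨s(b, x0), mem_star'.2 hx0⟩
  obtain ⟨ι, _, P, h1, h2, h3⟩ := ih _ (S ∪ T) hss
  have hoth : ∀ v, v ∉ X → v ≠ b → dg (E \ star' b X) v = dg E v := by
    intro v hvX hvb
    have := hdg v
    simpa only [hvb, hvX, if_false, add_zero] using this
  have hbd : dg (E \ star' b X) b + #X = dg E b := by
    have := hdg b
    simpa only [if_true] using this
  refine ⟨ι, inferInstance, P, h1, ?_, ?_, ?_, ?_, ?_, ?_, by omega⟩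
  · intro x hx
    apply h1.odd_pos
    have hd := hdg x
    simp only [(hX x hx).1, hx, if_true, if_false] at hd
    have he := (hXF x hx).1
    rwa [← hd, Nat.even_add_one, Nat.not_even_iff_odd] at he
  · intro v hvX hvb hvF hv0 h0
    have hd := hoth v hvX hvb
    by_cases ho : Odd (dg E v)
    · rw [← hd] at ho; exact h1.odd_pos ho h0
    · rw [Nat.not_odd_iff_even] at ho
      have hvS : v ∈ S := by
        by_contra hvS; exact hvF ⟨ho, hvS, hv0⟩
      have := h2 v (by simp [hvS]) (hd ▸ ho)
      omega
  · intro v hvT hvX hvb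
    have hd := hoth v hvX hvb
    exact h2 v (by simp [hvT]) (hd ▸ (hT v hvT).1)
  · intro ho
    apply h1.odd_pos
    have he := hb.1
    rw [← hbd] at he
    by_contra h
    rw [Nat.not_odd_iff_even] at h
    exact (Nat.not_even_iff_odd.2 ho) ((Nat.even_add.1 he).1 h)
  · intro hbT hev
    apply h2 b (by simp [hbT])
    have he := hb.1
    rw [← hbd] at he
    exact (Nat.even_add.1 he).2 hev
  · intro v hv hev
    have hvb : v ≠ b := by rintro rfl; exact hb.2.1 hv
    have hvX : v ∉ X := fun h => (hXF v h).2.1 hv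
    exact ⟨hvb, hvX, h2 v (by simp [hv]) (by rw [hoth v hvX hvb]; exact hev)⟩

lemma StI.finish {E : Finset (Sym2 V)} {S T X : Finset V} {b : V} {ι : Type} [Fintype ι] {P : ι → List V}
    (h : StI E S T X b P) (P' : ι → List V) (hP' : Dec E P') (hD : ∀ v, v ≠ b → v ∉ X → D P' v = D P v)
    (hw : 2 * #T ≤ #X + #X % 2) : Claim E S := by
  refine ⟨ι, inferInstance, P', hP', ?_, ?_⟩
  · intro v hv hev
    have := h.S2 v hv hev
    rw [hD v this.1 this.2.1]; exact this.2.2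
  · have := h.W
    omega

lemma StI.cyc {E : Finset (Sym2 V)} {S T X : Finset V} {b : V} {ι : Type} [Fintype ι] {P : ι → List V}
    (h : StI E S T X b P) (hX : ∀ x ∈ X, x ≠ b ∧ s(b, x) ∈ E) 
    (hN : ∀ v, s(b, v) ∈ E \ star' b X → D P v ≠ 0)
    (hw : ∀ k, 2 * k ≤ #X → 2 * #T + 6 * ((k + 3) / 4) ≤ #X + #X % 2) : Claim E S := by
  classical
  have hsub := star'_sub (fun x hx => (hX x hx).2)
  obtain ⟨K, P', k1, k2, k3, k4, k5, k6⟩ := pc h.dec b X (by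
    intro x hx
    refine ⟨(hX x hx).1, ?_⟩
    rw [Finset.mem_sdiff]; exact fun h' => h'.2 (mem_star'.2 hx)) h.X0 hN
  have hEv : (E \ star' b X).val + (X.image (fun x => s(b, x))).val = E.val := by
    change _ + (star' b X).val = _
    rw [← Finset.disjUnion_val _ _ Finset.sdiff_disjoint, Finset.disjUnion_eq_union,
      Finset.sdiff_union_of_subset hsub]
  rw [hEv] at k5
  have hlist : (((K.toList.map P)).map (_root_.cyc b)).sum =
      ∑ i ∈ K, (ed (P i) + {s(b, (P i).headI)} + {s(b, lst (P i))}) := by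
    rw [List.map_map, Finset.sum_map_toList]; rfl
  have hnd : (((K.toList.map P)).map (_root_.cyc b)).sum.Nodup := by
    rw [hlist]
    have := E.nodup
    rw [← k5, Multiset.nodup_add] at this
    exact this.2.1
  obtain ⟨t, ht, Ps, p1, p2, p3⟩ := cycles b (K.toList.map P) (by
    intro L hL
    obtain ⟨i, hi, rfl⟩ := List.mem_map.1 hL
    exact ⟨h.dec.nd i, h.dec.ne i, k1 i (by simpa using hi)⟩) hnd
  rw [hlist] at p3
  simp only [List.length_map, Finset.length_toList] at ht
  refine ⟨(↥(Kᶜ : Finset ι)) ⊕ Fin Ps.length, inferInstance, Sum.elim (fun i => P' i) (fun j => Ps.get j), ⟨?_, ?_, ?_⟩, ?_, ?_⟩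
  · rintro (i | j)
    · exact k3 i
    · exact (p2 _ (List.get_mem _ _)).1
  · rintro (i | j)
    · exact k4 i
    · exact (p2 _ (List.get_mem _ _)).2
  · rw [Fintype.sum_sum_type, ← k5, ← p3]
    congr 1
    · exact Finset.sum_coe_sort Kᶜ (fun i => ed (P' i))
    · simp
  · intro v hv hev
    have := h.S2 v hv hev
    have h6 := k6 v this.1 this.2.1
    unfold D
    rw [Fintype.sum_sum_type]
    have h7 : ∑ i : ↥(Kᶜ : Finset ι), en (Sum.elim (fun i : ↥(Kᶜ : Finset ι) => P' i) (fun j => Ps.get j) (Sum.inl i)) v = ∑ i ∈ Kᶜ, en (P' i) v :=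
      Finset.sum_coe_sort Kᶜ (fun i => en (P' i) v)
    rw [h7, h6]
    have := this.2.2
    omega
  · rw [Fintype.card_sum, Fintype.card_coe, Fintype.card_fin, p1]
    have c1 := Finset.card_compl K
    have c2 := Finset.card_le_univ K
    have := h.W
    have := hw #K k2
    omega
end casesI


open Finset
set_option linter.unusedSectionVars false

section casesI2
variable {V : Type*} [Inhabited V] [DecidableEq V] [Fintype V]

lemma zeros_sub {E : Finset (Sym2 V)} {S T X : Finset V} {b : V} {ι : Type} [Fintype ι] {P : ι → List V}
    (h : StI E S T X b P) (hXF : ∀ x ∈ X, inF E S x) (E0 : Finset (Sym2 V)) (hE0 : E0 ⊆ E) (x : V)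
    (hx : s(b, x) ∉ E0) (P' : ι → List V) (hD : ∀ v, v ≠ b → v ∉ X → D P' v = D P v) :
    univ.filter (fun v => s(x, v) ∈ E0 ∧ D P' v = 0) ⊆ (NF E S x).erase b := by
  intro v hv
  simp only [Finset.mem_filter, Finset.mem_univ, true_and] at hv
  have hvb : v ≠ b := by
    rintro rfl; rw [Sym2.eq_swap] at hv; exact hx hv.1
  rw [Finset.mem_erase, mem_NF]
  refine ⟨hvb, ?_, hE0 hv.1⟩
  by_cases hvX : v ∈ X
  · exact hXF v hvX
  · by_contra hF
    have := h.nF v hvX hvb hF (dg_ne_zero (hE0 hv.1))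
    rw [hD v hvb hvX] at hv
    exact this hv.2

lemma star'_union (b : V) (X Y : Finset V) : star' b (X ∪ Y) = star' b X ∪ star' b Y := Finset.image_union _ _

lemma rebuild {E : Finset (Sym2 V)} {X B : Finset V} {b : V} (hsub : star' b X ⊆ E) (hB : B ⊆ X) :
    (E \ star' b X ∪ star' b B) ∪ star' b (X \ B) = E := by
  rw [Finset.union_assoc, ← star'_union, Finset.union_sdiff_of_subset hB, Finset.sdiff_union_of_subset hsub]

lemma rebuild_sub {E : Finset (Sym2 V)} {X B : Finset V} {b : V} (hsub : star' b X ⊆ E) (hB : B ⊆ X) :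
    (E \ star' b X ∪ star' b B) ⊆ E := by
  conv_rhs => rw [← rebuild hsub hB]
  exact Finset.subset_union_left

lemma rebuild_not {E : Finset (Sym2 V)} {X B : Finset V} {b x : V} (hx : x ∈ X) (hxB : x ∉ B) :
    s(b, x) ∉ (E \ star' b X ∪ star' b B) := by
  rw [Finset.mem_union, Finset.mem_sdiff, mem_star', mem_star']
  tauto

lemma ins_star (b x : V) (E : Finset (Sym2 V)) : insert s(b, x) E = E ∪ star' b {x} := by
  rw [Finset.insert_eq, Finset.union_comm]; simp [star']

lemma NF_props {E : Finset (Sym2 V)} (hE : ∀ e ∈ E, ¬ e.IsDiag) {S : Finset V} {b : V} :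
    ∀ x ∈ NF E S b, x ≠ b ∧ s(b, x) ∈ E := by
  intro x hx
  rw [mem_NF] at hx
  exact ⟨(nodiag_ne hE hx.2).symm, hx.2⟩

lemma StI.N {E : Finset (Sym2 V)} (hE : ∀ e ∈ E, ¬ e.IsDiag) {S T : Finset V} {b : V} {ι : Type} [Fintype ι] {P : ι → List V}
    (h : StI E S T (NF E S b) b P) (v : V) (hv : s(b, v) ∈ E \ star' b (NF E S b)) : D P v ≠ 0 := by
  rw [Finset.mem_sdiff, mem_star'] at hv
  apply h.nF v hv.2 (nodiag_ne hE hv.1).symm _ (dg_ne_zero hv.1)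
  intro hF
  exact hv.2 (mem_NF.2 ⟨hF, hv.1⟩)

lemma erase_card {E : Finset (Sym2 V)} {S : Finset V} {b x : V} (hb : inF E S b)
    (hx : x ∈ NF E S b) : #((NF E S x).erase b) + 1 = #(NF E S x) := by
  apply Finset.card_erase_add_one
  rw [mem_NF] at hx ⊢
  rw [Sym2.eq_swap]; exact ⟨hb, hx.2⟩

lemma caseI_big {E : Finset (Sym2 V)} (hE : ∀ e ∈ E, ¬ e.IsDiag) (S : Finset V)
    (ih : ∀ E' S', E' ⊂ E → Claim (V := V) E' S') (b : V) (hb : inF E S b)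
    (h5 : 5 ≤ #(NF E S b)) (h10 : #(NF E S b) ≠ 10) : Claim E S := by
  obtain ⟨ι, _, P, h⟩ := setupI (T := ∅) ih hb (by simp) (NF_props hE) (fun x hx => (mem_NF.1 hx).1)
    (Finset.card_pos.1 (by omega))
  refine h.cyc (NF_props hE) (h.N hE) ?_
  intro k hk
  rw [Finset.card_empty]
  omega

lemma caseI_ten {E : Finset (Sym2 V)} (hE : ∀ e ∈ E, ¬ e.IsDiag) (S : Finset V)
    (ih : ∀ E' S', E' ⊂ E → Claim (V := V) E' S') (b : V) (hb : inF E S b)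
    (h10 : #(NF E S b) = 10) : Claim E S := by
  obtain ⟨x0, hx0⟩ := Finset.card_pos.1 (show 0 < #(NF E S b) by omega)
  have hc := Finset.card_erase_add_one hx0
  have hpr : ∀ x ∈ (NF E S b).erase x0, x ≠ b ∧ s(b, x) ∈ E := fun x hx => NF_props hE x (Finset.mem_of_mem_erase hx)
  obtain ⟨ι, _, P, h⟩ := setupI (T := {x0}) (X := (NF E S b).erase x0) ih hb
    (by intro v hv; rw [Finset.mem_singleton] at hv; subst hv; exact (mem_NF.1 hx0).1) hpr
    (fun x hx => (mem_NF.1 (Finset.mem_of_mem_erase hx)).1)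
    (Finset.card_pos.1 (by omega))
  refine h.cyc hpr ?_ ?_
  · intro v hv
    rw [Finset.mem_sdiff, mem_star'] at hv
    have hvb := (nodiag_ne hE hv.1).symm
    by_cases hvx : v = x0
    · have := h.T2 v (by simp [hvx]) hv.2 hvb
      omega
    · apply h.nF v hv.2 hvb _ (dg_ne_zero hv.1)
      intro hF
      exact hv.2 (Finset.mem_erase.2 ⟨hvx, mem_NF.2 ⟨hF, hv.1⟩⟩)
  · intro k hk
    rw [Finset.card_singleton]
    omega

lemma caseI_small {E : Finset (Sym2 V)} (hE : ∀ e ∈ E, ¬ e.IsDiag) (S : Finset V)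
    (ih : ∀ E' S', E' ⊂ E → Claim (V := V) E' S') (b : V) (hb : inF E S b)
    (h1 : 1 ≤ #(NF E S b)) (h3 : #(NF E S b) ≤ 3) (hmax : ∀ x, inF E S x → #(NF E S x) ≤ #(NF E S b)) : Claim E S := by
  set X := NF E S b with hXd
  have hXF : ∀ x ∈ X, inF E S x := fun x hx => (mem_NF.1 hx).1
  have hsub : star' b X ⊆ E := star'_sub (fun x hx => (NF_props hE x hx).2)
  set T : Finset V := if #X = 2 then {b} else ∅ with hT
  have hTc : 2 * #T ≤ #X + #X % 2 := by
    rw [hT]; split_ifs with h <;> simp [h]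
  obtain ⟨ι, _, P, h⟩ := setupI (T := T) (X := X) ih hb (by
    intro v hv; rw [hT] at hv; split_ifs at hv
    · rw [Finset.mem_singleton] at hv; subst hv; exact hb
    · simp at hv) (NF_props hE) hXF (Finset.card_pos.1 (by omega))
  have hDb : #X ≤ D P b + (#X + 1) / 2 := by
    by_cases h2 : #X = 2
    · have := h.b2 (by rw [hT, if_pos h2]; simp) (by rw [h2]; exact even_two)
      omega
    · have := h.b1 (by rw [Nat.odd_iff]; omega)
      omega
  obtain ⟨B, hBX, hBc, P1, d1, e1, f1⟩ := phase1 h.dec b X (by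
    intro x hx
    refine ⟨(NF_props hE x hx).1, ?_, h.X0 x hx⟩
    rw [Finset.mem_sdiff, mem_star']; exact fun h => h.2 hx) (h.N hE) ((#X + 1) / 2) (by omega)
  have hsd := Finset.card_sdiff_add_card_eq_card hBX
  have hreb := rebuild hsub hBX
  by_cases hR : X \ B = ∅
  · refine h.finish P1 ?_ (fun v hvb hvX => e1 v hvb (fun h => hvX (hBX h))) hTc
    rw [hR] at hreb
    simp only [star', Finset.image_empty, Finset.union_empty] at hreb
    rw [← hreb]; exact d1
  · have hR1 : #(X \ B) = 1 := by
      have := Finset.card_pos.2 (Finset.nonempty_iff_ne_empty.2 hR)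
      omega
    obtain ⟨x, hx⟩ := Finset.card_eq_one.1 hR1
    have hxX : x ∈ X \ B := by rw [hx]; simp
    rw [Finset.mem_sdiff] at hxX
    have hnot := rebuild_not (E := E) (b := b) hxX.1 hxX.2
    have hz := Finset.card_le_card (zeros_sub h hXF _ (rebuild_sub hsub hBX) x hnot P1
      (fun v hvb hvX => e1 v hvb (fun h => hvX (hBX h))))
    have hz2 := erase_card hb hxX.1
    have hz3 := hmax x (hXF x hxX.1)
    obtain ⟨P2, d2, e2, f2, g2⟩ := left1 d1 b x (NF_props hE x hxX.1).1 hnot (by omega)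
    refine h.finish P2 ?_ ?_ hTc
    · rw [ins_star, ← hx, hreb] at d2; exact d2
    · intro v hvb hvX
      rw [e2 v hvb (by rintro rfl; exact hvX hxX.1), e1 v hvb (fun h => hvX (hBX h))]

lemma caseI_four {E : Finset (Sym2 V)} (hE : ∀ e ∈ E, ¬ e.IsDiag) (S : Finset V)
    (ih : ∀ E' S', E' ⊂ E → Claim (V := V) E' S') (b : V) (hb : inF E S b)
    (h4 : #(NF E S b) = 4) (hmax : ∀ x, inF E S x → #(NF E S x) ≤ #(NF E S b)) : Claim E S := by
  set X := NF E S b with hXd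
  have hXF : ∀ x ∈ X, inF E S x := fun x hx => (mem_NF.1 hx).1
  have hsub : star' b X ⊆ E := star'_sub (fun x hx => (NF_props hE x hx).2)
  obtain ⟨x1, hx1⟩ := Finset.card_pos.1 (show 0 < #X by omega)
  have hc1 := Finset.card_erase_add_one hx1
  -- choose the extra set T
  obtain ⟨T, hbT, hTF, hTc, hTq⟩ : ∃ T : Finset V, b ∈ T ∧ (∀ v ∈ T, inF E S v) ∧ #T ≤ 2 ∧
      ((∃ q ∈ T, q ∈ NF E S x1 ∧ q ∉ X ∧ q ≠ b) ∨ NF E S x1 ⊆ insert b X) := by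
    by_cases hq : ∃ q ∈ NF E S x1, q ∉ insert b X
    · obtain ⟨q, hq, hq'⟩ := hq
      rw [Finset.mem_insert, not_or] at hq'
      refine ⟨{b, q}, by simp, ?_, Finset.card_le_two, Or.inl ⟨q, by simp, hq, hq'.2, hq'.1⟩⟩
      intro v hv
      rw [Finset.mem_insert, Finset.mem_singleton] at hv
      rcases hv with rfl | rfl
      · exact hb
      · exact (mem_NF.1 hq).1
    · push Not at hq
      refine ⟨{b}, by simp, ?_, by simp, Or.inr hq⟩
      intro v hv
      rw [Finset.mem_singleton] at hv; subst hv; exact hb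
  obtain ⟨ι, _, P, h⟩ := setupI (T := T) (X := X) ih hb hTF (NF_props hE) hXF ⟨x1, hx1⟩
  have hDb := h.b2 hbT (by rw [h4]; decide)
  obtain ⟨B, hBX', hBc, P1, d1, e1, f1⟩ := phase1 h.dec b (X.erase x1) (by
    intro x hx
    have hx := Finset.mem_of_mem_erase hx
    refine ⟨(NF_props hE x hx).1, ?_, h.X0 x hx⟩
    rw [Finset.mem_sdiff, mem_star']; exact fun h => h.2 hx) (h.N hE) 2 (by omega)
  have hBX : B ⊆ X := hBX'.trans (Finset.erase_subset _ _)
  have hx1B : x1 ∉ B := fun h => by simpa using hBX' h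
  have hsd := Finset.card_sdiff_add_card_eq_card hBX
  have hsd' := Finset.card_sdiff_add_card_eq_card hBX'
  have hreb := rebuild hsub hBX
  obtain ⟨x2, hx2⟩ := Finset.card_pos.1 (show 0 < #(X.erase x1 \ B) by omega)
  rw [Finset.mem_sdiff, Finset.mem_erase] at hx2
  obtain ⟨⟨hx21, hx2X⟩, hx2B⟩ := hx2
  have hRx : X \ B = {x2, x1} := by
    symm
    apply Finset.eq_of_subset_of_card_le
    · intro v hv
      rw [Finset.mem_insert, Finset.mem_singleton] at hv
      rw [Finset.mem_sdiff]
      rcases hv with rfl | rfl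
      exacts [⟨hx2X, hx2B⟩, ⟨hx1, hx1B⟩]
    · rw [Finset.card_pair hx21]; omega
  have hnot := rebuild_not (E := E) (b := b) hx2X hx2B
  have hz := Finset.card_le_card (zeros_sub h hXF _ (rebuild_sub hsub hBX) x2 hnot P1
    (fun v hvb hvX => e1 v hvb (fun h => hvX (hBX h))))
  have hz2 := erase_card hb hx2X
  have hz3 := hmax x2 (hXF x2 hx2X)
  obtain ⟨P2, d2, e2, f2, g2⟩ := left1 d1 b x2 (NF_props hE x2 hx2X).1 hnot (by omega)
  have hD2 : ∀ v, v ≠ b → v ∉ X → D P2 v = D P v := fun v hvb hvX => by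
    rw [e2 v hvb (by rintro rfl; exact hvX hx2X), e1 v hvb (fun h => hvX (hBX h))]
  have hnot2 : s(b, x1) ∉ insert s(b, x2) (E \ star' b X ∪ star' b B) := by
    rw [Finset.mem_insert, not_or]
    refine ⟨fun h => hx21 (Sym2.congr_right.1 h).symm, rebuild_not hx1 hx1B⟩
  have hsub2 : insert s(b, x2) (E \ star' b X ∪ star' b B) ⊆ E :=
    Finset.insert_subset (NF_props hE x2 hx2X).2 (rebuild_sub hsub hBX)
  have hzz := zeros_sub h hXF _ hsub2 x1 hnot2 P2 hD2
  have hw2 := erase_card hb hx1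
  have hw3 := hmax x1 (hXF x1 hx1)
  have hfin : #(univ.filter (fun v => s(x1, v) ∈ insert s(b, x2) (E \ star' b X ∪ star' b B) ∧ D P2 v = 0)) ≤ 2 := by
    rcases hTq with ⟨q, hqT, hqN, hqX, hqb⟩ | hNs
    · have hq2 := h.T2 q hqT hqX hqb
      rw [← hD2 q hqb hqX] at hq2
      have : univ.filter (fun v => s(x1, v) ∈ insert s(b, x2) (E \ star' b X ∪ star' b B) ∧ D P2 v = 0) ⊆
          ((NF E S x1).erase b).erase q := by
        intro v hv
        refine Finset.mem_erase.2 ⟨?_, hzz hv⟩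
        rintro rfl
        have := (Finset.mem_filter.1 hv).2.2
        omega
      have c := Finset.card_le_card this
      have c' := Finset.card_erase_add_one (show q ∈ (NF E S x1).erase b from Finset.mem_erase.2 ⟨hqb, hqN⟩)
      omega
    · have : univ.filter (fun v => s(x1, v) ∈ insert s(b, x2) (E \ star' b X ∪ star' b B) ∧ D P2 v = 0) ⊆
          (X.erase x1).erase x2 := by
        intro v hv
        have h5 := hzz hv
        rw [Finset.mem_erase] at h5
        refine Finset.mem_erase.2 ⟨?_, Finset.mem_erase.2 ⟨?_, ?_⟩⟩
        · rintro rfl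
          have := (Finset.mem_filter.1 hv).2.2
          omega
        · rintro rfl
          exact nodiag_ne hE (mem_NF.1 h5.2).2 rfl
        · exact (Finset.mem_insert.1 (hNs h5.2)).resolve_left h5.1
      have c := Finset.card_le_card this
      have c' := Finset.card_erase_add_one (show x2 ∈ X.erase x1 from Finset.mem_erase.2 ⟨hx21, hx2X⟩)
      omega
  obtain ⟨P3, d3, e3, f3, g3⟩ := left1 d2 b x1 (NF_props hE x1 hx1).1 hnot2 (by omega)
  refine h.finish P3 ?_ ?_ (by omega)
  · rw [ins_star, ins_star, Finset.union_assoc, ← star'_union, ← Finset.insert_eq, ← hRx, hreb] at d3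
    exact d3
  · intro v hvb hvX
    rw [e3 v hvb (by rintro rfl; exact hvX hx1), hD2 v hvb hvX]

lemma caseII {E : Finset (Sym2 V)} (hE : ∀ e ∈ E, ¬ e.IsDiag) (S : Finset V)
    (ih : ∀ E' S', E' ⊂ E → Claim (V := V) E' S') (b : V) (hb : ¬ inF E S b)
    (hne : (NF E S b).Nonempty) (hFF : ∀ x, inF E S x → NF E S x = ∅) : Claim E S := by
  classical
  set X := NF E S b with hXd
  have hXF : ∀ x ∈ X, inF E S x := fun x hx => (mem_NF.1 hx).1
  have hX := NF_props hE (S := S) (b := b)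
  rw [← hXd] at hX
  have hsub : star' b X ⊆ E := star'_sub (fun x hx => (hX x hx).2)
  have hdg := dg_star E b X hX
  obtain ⟨x0, hx0⟩ := hne
  have hb0 : dg E b ≠ 0 := dg_ne_zero (by rw [Sym2.eq_swap]; exact (hX x0 hx0).2)
  have hss : E \ star' b X ⊂ E := Finset.sdiff_ssubset hsub ⟨s(b, x0), mem_star'.2 hx0⟩
  have hX1 : 0 < #X := Finset.card_pos.2 ⟨x0, hx0⟩
  set S' : Finset V := if Odd (dg E b) then S.erase b else S with hS'
  have hSS : ∀ v, v ≠ b → (v ∈ S' ↔ v ∈ S) := by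
    intro v hv; rw [hS']; split_ifs <;> simp [hv]
  have hoth : ∀ v, v ∉ X → v ≠ b → dg (E \ star' b X) v = dg E v := by
    intro v hvX hvb
    have := hdg v
    simpa only [hvb, hvX, if_false, add_zero] using this
  have hbd : dg (E \ star' b X) b + #X = dg E b := by
    have := hdg b
    simpa only [if_true] using this
  obtain ⟨ι, _, P, h1, h2, h3⟩ := ih _ S' hss
  have hx_odd : ∀ x ∈ X, Odd (dg (E \ star' b X) x) := by
    intro x hx
    have hd := hdg x
    simp only [(hX x hx).1, hx, if_true, if_false] at hd
    have he := (hXF x hx).1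
    rwa [← hd, Nat.even_add_one, Nat.not_even_iff_odd] at he
  have hnF : ∀ v, v ∉ X → v ≠ b → ¬ inF E S v → dg E v ≠ 0 → D P v ≠ 0 := by
    intro v hvX hvb hvF hv0 h0
    have hd := hoth v hvX hvb
    by_cases ho : Odd (dg E v)
    · rw [← hd] at ho; exact h1.odd_pos ho h0
    · rw [Nat.not_odd_iff_even] at ho
      have hvS : v ∈ S := by
        by_contra hvS; exact hvF ⟨ho, hvS, hv0⟩
      have := h2 v ((hSS v hvb).2 hvS) (hd ▸ ho)
      omega
  obtain ⟨B, hBX, hBc, P1, d1, e1, f1⟩ := phase1 h1 b X (by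
    intro x hx
    refine ⟨(hX x hx).1, ?_, h1.odd_pos (hx_odd x hx)⟩
    rw [Finset.mem_sdiff, mem_star']; exact fun h => h.2 hx) (by
      intro v hv
      rw [Finset.mem_sdiff, mem_star'] at hv
      apply hnF v hv.2 (nodiag_ne hE hv.1).symm _ (dg_ne_zero hv.1)
      intro hF
      exact hv.2 (mem_NF.2 ⟨hF, hv.1⟩)) ((#X + 1) / 2) (by omega)
  have hsd := Finset.card_sdiff_add_card_eq_card hBX
  obtain ⟨P2, d2, e2, f2, g2⟩ := leftovers d1 b (X \ B) (by
    intro x hx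
    rw [Finset.mem_sdiff] at hx
    exact ⟨(hX x hx.1).1, rebuild_not hx.1 hx.2⟩) (by
    intro x hx v hv
    rw [Finset.mem_sdiff] at hx
    have hvE := rebuild_sub hsub hBX hv
    have hvb : v ≠ b := by
      rintro rfl; rw [Sym2.eq_swap] at hv; exact rebuild_not hx.1 hx.2 hv
    have hvF : ¬ inF E S v := by
      intro hF
      have : v ∈ NF E S x := mem_NF.2 ⟨hF, hvE⟩
      rw [hFF x (hXF x hx.1)] at this
      simp at this
    have hvX : v ∉ X := fun h => hvF (hXF v h)
    rw [e1 v hvb (fun h => hvX (hBX h))]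
    exact hnF v hvX hvb hvF (dg_ne_zero hvE)) (by omega)
  rw [rebuild hsub hBX] at d2
  have hD2 : ∀ v, v ≠ b → v ∉ X → D P2 v = D P v := fun v hvb hvX => by
    rw [e2 v hvb (fun h => hvX (Finset.mem_sdiff.1 h).1), e1 v hvb (fun h => hvX (hBX h))]
  refine ⟨ι, inferInstance, P2, d2, ?_, ?_⟩
  · intro v hv hev
    have hvX : v ∉ X := fun h => (hXF v h).2.1 hv
    by_cases hvb : v = b
    · subst hvb
      have hSb : v ∈ S' := by rw [hS', if_neg (Nat.not_odd_iff_even.2 hev)]; exact hv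
      have hp := d2.par v
      have hp2 := (Nat.even_add.1 hp).1 hev
      have hpos : D P2 v ≠ 0 := by
        by_cases ho : Odd (dg (E \ star' v X) v)
        · have := h1.odd_pos ho
          omega
        · have := h2 v hSb (Nat.not_odd_iff_even.1 ho)
          omega
      rw [Nat.even_iff] at hp2
      omega
    · rw [hD2 v hvb hvX]
      exact h2 v ((hSS v hvb).2 hv) (by rw [hoth v hvX hvb]; exact hev)
  · have key : ∀ v, wt (E \ star' b X) S' v + (if v ∈ X then 1 else 0) ≤ wt E S v + (if v = b then 1 else 0) := by
      intro v
      by_cases hvX : v ∈ X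
      · have hF := hXF v hvX
        simp [wt, hvX, (hX v hvX).1, hx_odd v hvX, Nat.not_odd_iff_even.2 hF.1, hF.2.1, hF.2.2]
      · by_cases hvb : v = b
        · subst hvb
          simp only [hvX, if_true, if_false, add_zero]
          by_cases ho : Odd (dg E v)
          · have : v ∉ S' := by rw [hS', if_pos ho]; simp
            simp only [wt, ho, this, if_true, if_false]
            split_ifs <;> omega
          · have hvS : v ∈ S := by
              by_contra hvS; exact hb ⟨Nat.not_odd_iff_even.1 ho, hvS, hb0⟩
            have := wt_le_six (E \ star' v X) S' v
            have q : wt E S v = 6 := by simp [wt, ho, hvS]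
            omega
        · have hd := hoth v hvX hvb
          simp [wt, hvX, hvb, hd, hSS v hvb]
    have := Finset.sum_le_sum (fun v (_ : v ∈ (univ : Finset V)) => key v)
    rw [Finset.sum_add_distrib, Finset.sum_add_distrib, ← Finset.card_filter] at this
    simp only [Finset.sum_ite_eq', Finset.mem_univ, if_true, Finset.filter_mem_eq_inter, Finset.univ_inter] at this
    omega

theorem claim (E : Finset (Sym2 V)) : (∀ e ∈ E, ¬ e.IsDiag) → ∀ S : Finset V, Claim E S := by
  induction E using Finset.strongInduction with
  | H E ih0 =>
  intro hE S
  have ih : ∀ E' S', E' ⊂ E → Claim (V := V) E' S' := fun E' S' h =>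
    ih0 E' h (fun e he => hE e (h.1 he)) S'
  by_cases hFe : ∃ v, inF E S v
  · obtain ⟨v, hv⟩ := hFe
    by_cases hFF : ∀ x, inF E S x → NF E S x = ∅
    · -- no edges inside F
      have : (E.filter (fun e => v ∈ e)).Nonempty := by
        rw [← Finset.card_ne_zero]; exact hv.2.2
      obtain ⟨e, he⟩ := this
      rw [Finset.mem_filter] at he
      obtain ⟨b, rfl⟩ := he.2
      have hvN : v ∈ NF E S b := mem_NF.2 ⟨hv, by rw [Sym2.eq_swap]; exact he.1⟩
      have hb : ¬ inF E S b := by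
        intro hb
        have := hFF b hb
        rw [this] at hvN; simp at hvN
      exact caseII hE S ih b hb ⟨v, hvN⟩ hFF
    · push Not at hFF
      obtain ⟨x, hx, hxn⟩ := hFF
      obtain ⟨b, hb, hmax⟩ := Finset.exists_max_image (univ.filter (fun v => inF E S v)) (fun v => #(NF E S v)) ⟨x, by simp [hx]⟩
      simp only [Finset.mem_filter, Finset.mem_univ, true_and] at hb hmax
      have h1 := hmax x hx
      have h2 := Finset.card_pos.2 hxn
      by_cases c1 : #(NF E S b) ≤ 3
      · exact caseI_small hE S ih b hb (by omega) c1 hmax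
      by_cases c2 : #(NF E S b) = 4
      · exact caseI_four hE S ih b hb c2 hmax
      by_cases c3 : #(NF E S b) = 10
      · exact caseI_ten hE S ih b hb c3
      · exact caseI_big hE S ih b hb (by omega) c3
  · push Not at hFe
    have hF : ∀ v, Odd (dg E v) ∨ v ∈ S ∨ dg E v = 0 := by
      intro v
      have := hFe v
      unfold inF at this
      by_contra hcon
      push Not at hcon
      exact this ⟨Nat.not_odd_iff_even.1 (by simpa using hcon.1), hcon.2.1, hcon.2.2⟩
    rcases E.eq_empty_or_nonempty with rfl | ⟨e, he⟩
    · exact claim_empty S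
    · induction e using Sym2.ind with
      | h a b =>
      by_cases hb : Odd (dg E b)
      · exact case0_odd hE S ih hF a b (by rwa [Sym2.eq_swap]) hb
      by_cases ha : Odd (dg E a)
      · exact case0_odd hE S ih hF b a he ha
      have hb0 := dg_ne_zero he
      have ha0 : dg E a ≠ 0 := dg_ne_zero (by rwa [Sym2.eq_swap] at he)
      exact case0_even hE S ih b a he (Nat.not_odd_iff_even.1 hb) (Nat.not_odd_iff_even.1 ha)
        (((hF b).resolve_left hb).resolve_right hb0) (((hF a).resolve_left ha).resolve_right ha0)

end casesI2


open Finset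

section conv
variable {V : Type*}

lemma exists_walk_of_list (G : SimpleGraph V) (l : List V) : ∀ a : V, (∀ e ∈ ed (a :: l), e ∈ G.edgeSet) →
    ∃ (v : V) (w : G.Walk a v), w.support = a :: l ∧ (w.edges : Multiset (Sym2 V)) = ed (a :: l) := by
  induction l with
  | nil =>
    intro a _
    exact ⟨a, SimpleGraph.Walk.nil, by simp, by simp⟩
  | cons b l ih =>
    intro a h
    obtain ⟨v, w, h1, h2⟩ := ih b (fun e he => h e (by simp [he]))
    have hab : G.Adj a b := h s(a, b) (by simp)
    refine ⟨v, SimpleGraph.Walk.cons hab w, by simp [h1], ?_⟩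
    rw [SimpleGraph.Walk.edges_cons, ← Multiset.cons_coe, h2, ed_cons_cons, Multiset.singleton_add]

/-- every other edge of a list -/
def al : List V → Multiset (Sym2 V)
  | [] => 0
  | [_] => 0
  | a :: b :: l => s(a, b) ::ₘ al l

lemma ed_eq_al : ∀ l : List V, ed l = al l + al l.tail
  | [] => by simp [al]
  | [_] => by simp [al]
  | a :: b :: l => by
    rw [ed_cons_cons, ed_eq_al (b :: l)]
    simp only [al, List.tail_cons, Multiset.singleton_add, Multiset.cons_add]
    rw [add_comm]

lemma card_al : ∀ l : List V, (al l).card = l.length / 2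
  | [] => by simp [al]
  | [_] => by simp [al]
  | a :: b :: l => by
    simp only [al, Multiset.card_cons, List.length_cons, card_al l]
    omega

lemma mem_of_mem_al : ∀ (l : List V) (e : Sym2 V) (v : V), e ∈ al l → v ∈ e → v ∈ l
  | [], e, v => by simp [al]
  | [_], e, v => by simp [al]
  | a :: b :: l, e, v => by
    intro he hv
    simp only [al, Multiset.mem_cons] at he
    rcases he with rfl | he
    · simp at hv; rcases hv with rfl | rfl <;> simp
    · have := mem_of_mem_al l e v he hv
      simp [this]

lemma al_matching : ∀ (l : List V), l.Nodup → ∀ (e e' : Sym2 V) (v : V), e ∈ al l → e' ∈ al l →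
    v ∈ e → v ∈ e' → e = e'
  | [], _, e, e', v => by simp [al]
  | [_], _, e, e', v => by simp [al]
  | a :: b :: l, hl, e, e', v => by
    intro he he' hv hv'
    simp only [List.nodup_cons, List.mem_cons, not_or] at hl
    simp only [al, Multiset.mem_cons] at he he'
    rcases he with rfl | he <;> rcases he' with rfl | he'
    · rfl
    · have := mem_of_mem_al l e' v he' hv'
      simp at hv
      rcases hv with rfl | rfl
      · exact absurd this hl.1.2
      · exact absurd this hl.2.1
    · have := mem_of_mem_al l e v he hv
      simp at hv'
      rcases hv' with rfl | rfl
      · exact absurd this hl.1.2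
      · exact absurd this hl.2.1
    · exact al_matching l hl.2.2 e e' v he he' hv hv'

lemma exists_matching (G : SimpleGraph V) (l : List V) (hl : l.Nodup) (hG : ∀ e ∈ al l, e ∈ G.edgeSet) :
    ∃ H : G.Subgraph, H.IsMatching ∧ H.edgeSet = {e | e ∈ al l} := by
  refine ⟨{ verts := {v | ∃ w, s(v, w) ∈ al l}
            Adj := fun v w => s(v, w) ∈ al l
            adj_sub := fun {v w} h => hG _ h
            edge_vert := fun {v w} h => ⟨w, h⟩
            symm := ⟨fun v w h => by rwa [Sym2.eq_swap]⟩ }, ?_, ?_⟩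
  · rintro v ⟨w, hw⟩
    refine ⟨w, hw, ?_⟩
    intro y hy
    have := al_matching l hl _ _ v hy hw (by simp) (by simp)
    exact Sym2.congr_right.1 this
  · ext e
    induction e using Sym2.ind with
    | h a b => simp

lemma Dec.mem_of {ι : Type} [Fintype ι] {E : Finset (Sym2 V)} {P : ι → List V} (h : Dec E P) {i : ι}
    {e : Sym2 V} (he : e ∈ ed (P i)) : e ∈ E := by
  classical
  haveI : Inhabited V := ⟨(P i).head (h.ne i)⟩
  exact h.mem he

lemma Dec.idx_of {ι : Type} [Fintype ι] {E : Finset (Sym2 V)} {P : ι → List V} (h : Dec E P) {i j : ι}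
    {e : Sym2 V} (he : e ∈ ed (P i)) (he' : e ∈ ed (P j)) : i = j := by
  classical
  haveI : Inhabited V := ⟨(P i).head (h.ne i)⟩
  exact h.idx he he'

lemma exists_dec [Fintype V] (G : SimpleGraph V) : ∃ (ι : Type) (_ : Fintype ι) (P : ι → List V) (E : Finset (Sym2 V)),
    Dec E P ∧ (E : Set (Sym2 V)) = G.edgeSet ∧ 3 * Fintype.card ι ≤ 2 * Fintype.card V := by
  classical
  rcases isEmpty_or_nonempty V with hV | hV
  · refine ⟨Empty, inferInstance, Empty.elim, ∅, ⟨fun i => i.elim, fun i => i.elim, by simp⟩, ?_, by simp⟩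
    ext e
    induction e using Sym2.ind with
    | h a b => exact hV.elim a
  · inhabit V
    obtain ⟨ι, hι, P, hP, -, hc⟩ := claim G.edgeFinset (fun e he =>
      G.not_isDiag_of_mem_edgeSet (by simpa using he)) (∅ : Finset V)
    refine ⟨ι, hι, P, G.edgeFinset, hP, by simp, ?_⟩
    have : ∑ v, wt G.edgeFinset ∅ v ≤ ∑ v : V, 4 := by
      refine Finset.sum_le_sum fun v _ => ?_
      unfold wt
      split_ifs <;> simp_all
    simp at this
    omega

lemma dean_kouider [Fintype V] (G : SimpleGraph V) :
    ∃ P : Finset G.Subgraph,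
      (3 * P.card ≤ 2 * Fintype.card V) ∧
      (∀ H ∈ P, ∃ (u v : V) (w : G.Walk u v), w.IsPath ∧ H = w.toSubgraph) ∧
      (∀ H ∈ P, ∀ H' ∈ P, H ≠ H' → Disjoint H.edgeSet H'.edgeSet) ∧
      (⋃ H ∈ (P : Set G.Subgraph), H.edgeSet) = G.edgeSet := by
  classical
  obtain ⟨ι, hι, P, E, hP, hE, hc⟩ := exists_dec G
  have key : ∀ i, ∃ H : G.Subgraph, (∃ (u v : V) (w : G.Walk u v), w.IsPath ∧ H = w.toSubgraph) ∧
      ∀ e, e ∈ H.edgeSet ↔ e ∈ ed (P i) := by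
    intro i
    obtain ⟨a, l, hal⟩ := List.exists_cons_of_ne_nil (hP.ne i)
    obtain ⟨v, w, h1, h2⟩ := exists_walk_of_list G l a (fun e he => by
      rw [← hE]; exact hP.mem_of (i := i) (by rwa [hal]))
    refine ⟨w.toSubgraph, ⟨a, v, w, ?_, rfl⟩, fun e => ?_⟩
    · rw [SimpleGraph.Walk.isPath_def, h1, ← hal]; exact hP.nd i
    · rw [hal, ← h2]; simp
  choose H hH1 hH2 using key
  refine ⟨Finset.univ.image H, ?_, ?_, ?_, ?_⟩
  · have := Finset.card_image_le (s := Finset.univ) (f := H)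
    rw [Finset.card_univ] at this
    omega
  · intro K hK
    obtain ⟨i, -, rfl⟩ := Finset.mem_image.1 hK
    exact hH1 i
  · intro K hK K' hK' hne
    obtain ⟨i, -, rfl⟩ := Finset.mem_image.1 hK
    obtain ⟨j, -, rfl⟩ := Finset.mem_image.1 hK'
    rw [Set.disjoint_left]
    intro e he he'
    exact hne (by rw [hP.idx_of ((hH2 i e).1 he) ((hH2 j e).1 he')])
  · ext e
    rw [← hE]
    simp only [Finset.coe_image, Finset.coe_univ, Set.image_univ, Set.mem_range, Set.iUnion_exists,
      Set.iUnion_iUnion_eq', Set.mem_iUnion, hH2, Finset.mem_coe]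
    rw [← Finset.mem_val, ← hP.sum, Multiset.mem_sum]
    simp

lemma matching_cor [Fintype V] (G : SimpleGraph V) (ε : ℝ) (hε : 0 < ε)
    (he : (2 * Fintype.card V : ℝ) / ε ≤ G.edgeSet.ncard) :
      ∃ M : Finset G.Subgraph,
        M.card ≤ 2 * Fintype.card V ∧
        (∀ H ∈ M, H.IsMatching) ∧
        (∀ H ∈ M, ∀ H' ∈ M, H ≠ H' → Disjoint H.edgeSet H'.edgeSet) ∧
        (∀ H ∈ M, ε * G.edgeSet.ncard / (2 * Fintype.card V) ≤ (H.edgeSet.ncard : ℝ)) ∧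
        ((G.edgeSet \ ⋃ H ∈ (M : Set G.Subgraph), H.edgeSet).ncard : ℝ)
          ≤ 2 * ε * G.edgeSet.ncard := by
  classical
  rcases isEmpty_or_nonempty V with hV | hV
  · have h0 : G.edgeSet = ∅ := by
      ext e
      induction e using Sym2.ind with
      | h a b => exact hV.elim a
    refine ⟨∅, by simp, by simp, by simp, by simp, by simp [h0]⟩
  obtain ⟨ι, hι, P, E, hP, hE, hc⟩ := exists_dec G
  have hn : (0 : ℝ) < Fintype.card V := by exact_mod_cast Fintype.card_pos
  set n : ℝ := (Fintype.card V : ℝ) with hn_def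
  set m : ℝ := (G.edgeSet.ncard : ℝ) with hm_def
  rw [div_le_iff₀ hε] at he
  set x : ℝ := ε * m / n with hx_def
  have hxn : x * n = ε * m := by rw [hx_def]; field_simp
  have hx2 : 2 ≤ x := by
    rw [hx_def, le_div_iff₀ hn]; linarith
  let Q : ι × Bool → List V := fun p => if p.2 then P p.1 else (P p.1).tail
  have hQ : ∀ i, ed (P i) = al (Q (i, true)) + al (Q (i, false)) := fun i => by
    simpa [Q] using ed_eq_al (P i)
  have hQm : ∀ p e, e ∈ al (Q p) → e ∈ ed (P p.1) := by
    rintro ⟨i, b⟩ e h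
    rw [hQ i, Multiset.mem_add]
    cases b
    · exact Or.inr h
    · exact Or.inl h
  have hnd : ∀ i, (ed (P i)).Nodup := fun i => by
    refine Multiset.nodup_of_le ?_ E.nodup
    rw [← hP.sum]
    exact Finset.single_le_sum (f := fun i => ed (P i)) (fun _ _ => Multiset.zero_le _) (Finset.mem_univ i)
  have hdj : ∀ p q e, e ∈ al (Q p) → e ∈ al (Q q) → p = q := by
    rintro ⟨i, b⟩ ⟨j, c⟩ e h h'
    obtain rfl : i = j := hP.idx_of (hQm _ e h) (hQm _ e h')
    have := hnd i
    rw [hQ i, Multiset.nodup_add] at this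
    have hd : e ∈ al (Q (i, true)) → e ∉ al (Q (i, false)) := fun hh => Multiset.disjoint_left.1 this.2.2 hh
    cases b <;> cases c
    · rfl
    · exact absurd h (hd h')
    · exact absurd h' (hd h)
    · rfl
  have hQnd : ∀ p, (al (Q p)).Nodup := by
    rintro ⟨i, b⟩
    have := hnd i
    rw [hQ i, Multiset.nodup_add] at this
    cases b
    · exact this.2.1
    · exact this.1
  have key : ∀ p, ∃ H : G.Subgraph, H.IsMatching ∧ H.edgeSet = {e | e ∈ al (Q p)} := by
    intro p
    refine exists_matching G (Q p) ?_ ?_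
    · simp only [Q]
      split_ifs
      · exact hP.nd _
      · exact (hP.nd _).tail
    · intro e h
      rw [← hE]
      exact hP.mem_of (hQm p e h)
  choose H hH1 hH2 using key
  have hlen : ∀ i, (ed (P i)).card + 1 = (P i).length := by
    intro i
    have h1 := hP.ne i
    have : 0 < (P i).length := List.length_pos_iff.2 h1
    rw [ed_eq_al, Multiset.card_add, card_al, card_al, List.length_tail]
    omega
  have hcard : ∀ p, (ed (P p.1)).card ≤ 2 * (al (Q p)).card + 1 := by
    rintro ⟨i, b⟩
    have := hlen i
    rw [card_al]
    cases b
    · simp only [Q, Bool.false_eq_true, if_false, List.length_tail]; omega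
    · simp only [Q, if_true]; omega
  have hHc : ∀ p, (H p).edgeSet.ncard = (al (Q p)).card := by
    intro p
    rw [hH2]
    have : {e | e ∈ al (Q p)} = (((al (Q p)).toFinset : Finset (Sym2 V)) : Set (Sym2 V)) := by
      ext e; simp
    rw [this, Set.ncard_coe_finset, Multiset.toFinset_card_of_nodup (hQnd p)]
  let B : Finset ι := Finset.univ.filter fun i => 2 * x < (ed (P i)).card
  refine ⟨(B ×ˢ Finset.univ).image H, ?_, ?_, ?_, ?_, ?_⟩
  · have h1 := Finset.card_image_le (s := B ×ˢ (Finset.univ : Finset Bool)) (f := H)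
    rw [Finset.card_product] at h1
    have h2 : #B ≤ Fintype.card ι := Finset.card_le_univ B
    rw [Finset.card_univ, Fintype.card_bool] at h1
    omega
  · intro K hK
    obtain ⟨p, -, rfl⟩ := Finset.mem_image.1 hK
    exact hH1 p
  · intro K hK K' hK' hne
    obtain ⟨p, -, rfl⟩ := Finset.mem_image.1 hK
    obtain ⟨q, -, rfl⟩ := Finset.mem_image.1 hK'
    rw [Set.disjoint_left]
    intro e h h'
    rw [hH2] at h h'
    exact hne (by rw [hdj p q e h h'])
  · intro K hK
    obtain ⟨p, hp, rfl⟩ := Finset.mem_image.1 hK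
    have hp1 : 2 * x < (ed (P p.1)).card := by
      have := (Finset.mem_product.1 hp).1
      simpa [B] using this
    have h2 : ((ed (P p.1)).card : ℝ) ≤ 2 * (al (Q p)).card + 1 := by exact_mod_cast hcard p
    rw [hHc]
    have : ε * m / (2 * n) = x / 2 := by rw [hx_def]; field_simp
    rw [this]
    linarith
  · have hsub : (G.edgeSet \ ⋃ K ∈ (((B ×ˢ Finset.univ).image H : Finset G.Subgraph) : Set G.Subgraph), K.edgeSet) ⊆
        ((Bᶜ.biUnion fun i => (ed (P i)).toFinset : Finset (Sym2 V)) : Set (Sym2 V)) := by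
      rintro e ⟨h, h'⟩
      rw [← hE, Finset.mem_coe, ← Finset.mem_val, ← hP.sum, Multiset.mem_sum] at h
      obtain ⟨i, -, hi⟩ := h
      rw [Finset.mem_coe, Finset.mem_biUnion]
      refine ⟨i, ?_, by simpa using hi⟩
      rw [Finset.mem_compl]
      intro hiB
      apply h'
      rw [hQ, Multiset.mem_add] at hi
      simp only [Set.mem_iUnion]
      rcases hi with hi | hi
      · exact ⟨H (i, true), Finset.mem_coe.2 (Finset.mem_image_of_mem H (by simp [hiB])), by rw [hH2]; exact hi⟩
      · exact ⟨H (i, false), Finset.mem_coe.2 (Finset.mem_image_of_mem H (by simp [hiB])), by rw [hH2]; exact hi⟩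
    have h1 := Set.ncard_le_ncard hsub (Finset.finite_toSet _)
    rw [Set.ncard_coe_finset] at h1
    have h2 : #(Bᶜ.biUnion fun i => (ed (P i)).toFinset) ≤ ∑ i ∈ Bᶜ, (ed (P i)).card :=
      Finset.card_biUnion_le.trans (Finset.sum_le_sum fun i _ => Multiset.toFinset_card_le _)
    have h3 : ((∑ i ∈ Bᶜ, (ed (P i)).card : ℕ) : ℝ) ≤ #Bᶜ * (2 * x) := by
      rw [Nat.cast_sum, ← nsmul_eq_mul]
      refine Finset.sum_le_card_nsmul _ _ _ fun i hi => ?_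
      simpa [B] using hi
    have h4 : (3 * (#Bᶜ : ℝ)) ≤ 2 * n := by
      have : #Bᶜ ≤ Fintype.card ι := Finset.card_le_univ _
      have : 3 * #Bᶜ ≤ 2 * Fintype.card V := by omega
      rw [hn_def]
      exact_mod_cast this
    have h5 := (Nat.cast_le (α := ℝ)).2 (h1.trans h2)
    refine h5.trans (h3.trans ?_)
    have : (#Bᶜ : ℝ) ≤ n := by linarith
    nlinarith
end conv

end DK



/-- Dean–Kouider path decomposition, together with the matching-decomposition corollary. -/
theorem stmt_15 (V : Type*) [Fintype V] (n : ℕ) (hn : Fintype.card V = n)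
    (G : SimpleGraph V) :
    (∃ P : Finset G.Subgraph,
      (3 * P.card ≤ 2 * n) ∧
      (∀ H ∈ P, ∃ (u v : V) (w : G.Walk u v), w.IsPath ∧ H = w.toSubgraph) ∧
      (∀ H ∈ P, ∀ H' ∈ P, H ≠ H' → Disjoint H.edgeSet H'.edgeSet) ∧
      (⋃ H ∈ (P : Set G.Subgraph), H.edgeSet) = G.edgeSet) ∧
    (∀ ε : ℝ, 0 < ε → (2 * n : ℝ) / ε ≤ G.edgeSet.ncard →
      ∃ M : Finset G.Subgraph,
        M.card ≤ 2 * n ∧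
        (∀ H ∈ M, H.IsMatching) ∧
        (∀ H ∈ M, ∀ H' ∈ M, H ≠ H' → Disjoint H.edgeSet H'.edgeSet) ∧
        (∀ H ∈ M, ε * G.edgeSet.ncard / (2 * n) ≤ (H.edgeSet.ncard : ℝ)) ∧
        ((G.edgeSet \ ⋃ H ∈ (M : Set G.Subgraph), H.edgeSet).ncard : ℝ)
          ≤ 2 * ε * G.edgeSet.ncard) := by
  subst hn
  exact ⟨dean_kouider G, fun ε hε he => matching_cor G ε hε he⟩
end
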